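/- (Proposition 3, case D≥4) Let D ≥ 4, set a = 1/(D−2) and b = 1/((D−1)(D−2)), and let T_{ij} be a real-analytic symmetric tensor field on ℝ^D satisfying ∂_j T_{ij}=0 for all i. Then there exists a real-analytic symmetric tensor field R_{ij} on ℝ^D, with trace R = δ^{ij}R_{ij}, such that T_{ij} = a ΔR_{ij} − 2a ∂_k∂_{(i}R_{j)k} + b ∂_i∂_j R + (a ∂_k∂_p R_{kp} − b ΔR) δ_{ij} (sums over k,p). -/

import Mathlib

/-- Partial derivative in the k-th Cartesian coordinate direction on ℝ^D. -/
noncomputable def pd {D : ℕ} (k : Fin D) (f : (Fin D → ℝ) → ℝ) : (Fin D → ℝ) → ℝ :=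
  fun x => fderiv ℝ f x (Pi.single k 1)

/-- Euclidean Laplacian Σ_k ∂_k∂_k. -/
noncomputable def lap {D : ℕ} (f : (Fin D → ℝ) → ℝ) : (Fin D → ℝ) → ℝ :=
  fun x => ∑ k, pd k (pd k f) x

/-- Formula (16c): T_{ij} = a ΔR_{ij} − 2a ∂_k∂_{(i}R_{j)k} + b ∂_i∂_j R
    + (a ∂_k∂_p R_{kp} − b ΔR) δ_{ij}, where R = δ^{ij} R_{ij}. -/
noncomputable def Tform {D : ℕ} (a b : ℝ) (Rt : Fin D → Fin D → (Fin D → ℝ) → ℝ)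
    (i j : Fin D) : (Fin D → ℝ) → ℝ :=
  fun x =>
    a * lap (Rt i j) x
    - 2 * a * ((1/2 : ℝ) * ((∑ k, pd k (pd i (Rt j k)) x) + (∑ k, pd k (pd j (Rt i k)) x)))
    + b * pd i (pd j (fun y => ∑ m, Rt m m y)) x
    + (a * (∑ k, ∑ p, pd k (pd p (Rt k p)) x) - b * lap (fun y => ∑ m, Rt m m y) x)
      * (if i = j then (1 : ℝ) else 0)

open Filter Topology MeasureTheory Set
open scoped ContDiff

section PartialDerivatives

variable {D : ℕ}

theorem ContDiff.pd {f : (Fin D → ℝ) → ℝ} (hf : ContDiff ℝ ∞ f) (i : Fin D) :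
    ContDiff ℝ ∞ (pd i f) := by
  have h : ContDiff ℝ ∞ (fderiv ℝ f) := hf.fderiv_right (by simp)
  exact h.clm_apply contDiff_const

theorem fderiv_apply_eq_sum_pd (f : (Fin D → ℝ) → ℝ) (x v : Fin D → ℝ) :
    fderiv ℝ f x v = ∑ i, v i * pd i f x := by
  conv_lhs => rw [← Finset.univ_sum_single v]
  rw [map_sum]
  refine Finset.sum_congr rfl fun i _ => ?_
  have : (Pi.single i (v i) : Fin D → ℝ) = v i • Pi.single i 1 := by
    rw [← Pi.single_smul]; simp
  rw [this, map_smul]; rfl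

theorem ContDiff.diffAt {f : (Fin D → ℝ) → ℝ} (hf : ContDiff ℝ ∞ f) (x : Fin D → ℝ) :
    DifferentiableAt ℝ f x := (hf.differentiable (by simp)) x

theorem pd_const (i : Fin D) (c : ℝ) : pd i (fun _ => c) = fun _ => 0 := by
  funext x; simp [pd]

theorem pd_add {f g : (Fin D → ℝ) → ℝ} (hf : ContDiff ℝ ∞ f) (hg : ContDiff ℝ ∞ g) (i : Fin D) :
    pd i (fun x => f x + g x) = fun x => pd i f x + pd i g x := by
  funext x; simp [pd, fderiv_fun_add (hf.diffAt x) (hg.diffAt x)]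

theorem pd_sub {f g : (Fin D → ℝ) → ℝ} (hf : ContDiff ℝ ∞ f) (hg : ContDiff ℝ ∞ g) (i : Fin D) :
    pd i (fun x => f x - g x) = fun x => pd i f x - pd i g x := by
  funext x; simp [pd, fderiv_fun_sub (hf.diffAt x) (hg.diffAt x)]

theorem pd_neg (f : (Fin D → ℝ) → ℝ) (i : Fin D) :
    pd i (fun x => - f x) = fun x => - pd i f x := by
  funext x; simp [pd, fderiv_fun_neg]

theorem pd_mul {f g : (Fin D → ℝ) → ℝ} (hf : ContDiff ℝ ∞ f) (hg : ContDiff ℝ ∞ g) (i : Fin D) :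
    pd i (fun x => f x * g x) = fun x => pd i f x * g x + f x * pd i g x := by
  funext x; simp [pd, fderiv_fun_mul (hf.diffAt x) (hg.diffAt x)]; ring

theorem pd_const_mul {f : (Fin D → ℝ) → ℝ} (hf : ContDiff ℝ ∞ f) (c : ℝ) (i : Fin D) :
    pd i (fun x => c * f x) = fun x => c * pd i f x := by
  rw [pd_mul contDiff_const hf, pd_const]; simp

theorem pd_sum {ι : Type*} {s : Finset ι} {f : ι → (Fin D → ℝ) → ℝ}
    (hf : ∀ a, ContDiff ℝ ∞ (f a)) (i : Fin D) :
    pd i (fun x => ∑ a ∈ s, f a x) = fun x => ∑ a ∈ s, pd i (f a) x := by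
  funext x
  simp [pd, fderiv_fun_sum fun a _ => (hf a).diffAt x]

theorem contDiff_coord (i : Fin D) : ContDiff ℝ ∞ (fun x : Fin D → ℝ => x i) :=
  contDiff_apply ℝ ℝ i

theorem pd_coord (k i : Fin D) :
    pd k (fun x : Fin D → ℝ => x i) = fun _ => if i = k then 1 else 0 := by
  funext x
  have : HasFDerivAt (fun x : Fin D → ℝ => x i)
      (ContinuousLinearMap.proj (R := ℝ) (φ := fun _ : Fin D => ℝ) i) x :=
    (ContinuousLinearMap.proj (R := ℝ) (φ := fun _ : Fin D => ℝ) i).hasFDerivAt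
  simp [pd, this.fderiv, Pi.single_apply]

theorem pd_comm {f : (Fin D → ℝ) → ℝ} (hf : ContDiff ℝ ∞ f) (i j : Fin D) :
    pd i (pd j f) = pd j (pd i f) := by
  funext x
  have hs : IsSymmSndFDerivAt ℝ f x :=
    hf.contDiffAt.isSymmSndFDerivAt (by
      simp only [minSmoothness_of_isRCLikeNormedField]; exact WithTop.coe_le_coe.2 le_top)
  have h : Differentiable ℝ (fderiv ℝ f) :=
    (hf.fderiv_right (m := ∞) (by simp)).differentiable (by simp)
  have key : ∀ a b : Fin D, pd a (pd b f) x
      = fderiv ℝ (fderiv ℝ f) x (Pi.single a 1) (Pi.single b 1) := by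
    intro a b
    change fderiv ℝ (fun y => fderiv ℝ f y (Pi.single b 1)) x (Pi.single a 1) = _
    rw [fderiv_clm_apply (h x) (differentiableAt_const _)]
    simp
  rw [key, key]; exact hs _ _

theorem ContDiff.lap {f : (Fin D → ℝ) → ℝ} (hf : ContDiff ℝ ∞ f) : ContDiff ℝ ∞ (lap f) :=
  ContDiff.sum fun k _ => (hf.pd k).pd k

theorem lap_add {f g : (Fin D → ℝ) → ℝ} (hf : ContDiff ℝ ∞ f) (hg : ContDiff ℝ ∞ g) :
    lap (fun x => f x + g x) = fun x => lap f x + lap g x := by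
  funext x
  simp [lap, pd_add hf hg, pd_add (hf.pd _) (hg.pd _), Finset.sum_add_distrib]

theorem lap_sub {f g : (Fin D → ℝ) → ℝ} (hf : ContDiff ℝ ∞ f) (hg : ContDiff ℝ ∞ g) :
    lap (fun x => f x - g x) = fun x => lap f x - lap g x := by
  funext x
  simp [lap, pd_sub hf hg, pd_sub (hf.pd _) (hg.pd _), Finset.sum_sub_distrib]

theorem lap_const_mul {f : (Fin D → ℝ) → ℝ} (hf : ContDiff ℝ ∞ f) (c : ℝ) :
    lap (fun x => c * f x) = fun x => c * lap f x := by
  funext x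
  simp [lap, pd_const_mul hf, pd_const_mul (hf.pd _), Finset.mul_sum]

theorem lap_sum {ι : Type*} {s : Finset ι} {f : ι → (Fin D → ℝ) → ℝ}
    (hf : ∀ a, ContDiff ℝ ∞ (f a)) :
    lap (fun x => ∑ a ∈ s, f a x) = fun x => ∑ a ∈ s, lap (f a) x := by
  funext x
  simp only [lap, pd_sum hf, pd_sum fun a => (hf a).pd _]
  exact Finset.sum_comm

theorem pd_lap {f : (Fin D → ℝ) → ℝ} (hf : ContDiff ℝ ∞ f) (i : Fin D) :
    pd i (lap f) = lap (pd i f) := by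
  change pd i (fun x => ∑ k, pd k (pd k f) x) = fun x => ∑ k, pd k (pd k (pd i f)) x
  rw [pd_sum fun k => (hf.pd k).pd k]
  funext x
  refine Finset.sum_congr rfl fun k _ => ?_
  rw [pd_comm (hf.pd k) i k, pd_comm hf i k]

theorem pd_congr_of_eventuallyEq {f g : (Fin D → ℝ) → ℝ} {x : Fin D → ℝ} (h : f =ᶠ[𝓝 x] g)
    (i : Fin D) : pd i f =ᶠ[𝓝 x] pd i g := by
  filter_upwards [h.fderiv (𝕜 := ℝ)] with y hy
  simp [pd, hy]

/-- Iterated partial derivative along a list of directions. -/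
noncomputable def pds (l : List (Fin D)) (f : (Fin D → ℝ) → ℝ) : (Fin D → ℝ) → ℝ :=
  l.foldr pd f

@[simp] theorem pds_nil (f : (Fin D → ℝ) → ℝ) : pds [] f = f := rfl

@[simp] theorem pds_cons (i : Fin D) (l : List (Fin D)) (f : (Fin D → ℝ) → ℝ) :
    pds (i :: l) f = pd i (pds l f) := rfl

theorem pds_append_singleton (i : Fin D) (l : List (Fin D)) (f : (Fin D → ℝ) → ℝ) :
    pds (l ++ [i]) f = pds l (pd i f) := by
  simp [pds]

theorem ContDiff.pds {f : (Fin D → ℝ) → ℝ} (hf : ContDiff ℝ ∞ f) :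
    ∀ l : List (Fin D), ContDiff ℝ ∞ (pds l f)
  | [] => hf
  | i :: l => (ContDiff.pds hf l).pd i

theorem pds_lap {f : (Fin D → ℝ) → ℝ} (hf : ContDiff ℝ ∞ f) (l : List (Fin D)) :
    pds l (lap f) = lap (pds l f) := by
  induction l with
  | nil => rfl
  | cons i l ih => rw [pds_cons, ih, pd_lap (hf.pds l), pds_cons]

theorem pds_congr_of_eventuallyEq {f g : (Fin D → ℝ) → ℝ} {x : Fin D → ℝ} (h : f =ᶠ[𝓝 x] g)
    (l : List (Fin D)) : pds l f =ᶠ[𝓝 x] pds l g := by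
  induction l with
  | nil => exact h
  | cons i l ih => exact pd_congr_of_eventuallyEq ih i

theorem pds_zero (l : List (Fin D)) : pds l (fun _ => 0) = fun _ => 0 := by
  induction l with
  | nil => rfl
  | cons i l ih => rw [pds_cons, ih, pd_const]

/-- A class of differentiable functions stable under partial derivatives consists of smooth
functions. -/
theorem contDiff_of_forall_pd (P : ((Fin D → ℝ) → ℝ) → Prop)
    (hd : ∀ f, P f → Differentiable ℝ f) (hp : ∀ f, P f → ∀ i, P (pd i f))
    {f : (Fin D → ℝ) → ℝ} (hf : P f) : ContDiff ℝ ∞ f := by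
  rw [contDiff_infty]
  intro n
  induction n generalizing f with
  | zero => exact contDiff_zero.2 (hd f hf).continuous
  | succ n ih =>
    rw [Nat.cast_add, Nat.cast_one, contDiff_succ_iff_fderiv]
    refine ⟨hd f hf, by simp, ?_⟩
    have : fderiv ℝ f = fun x => ∑ i, pd i f x •
        (ContinuousLinearMap.proj (R := ℝ) (φ := fun _ : Fin D => ℝ) i) := by
      funext x; ext v
      simp [fderiv_apply_eq_sum_pd, mul_comm]
    rw [this]
    exact ContDiff.sum fun i _ => (ih (hp f hf i)).smul contDiff_const

end PartialDerivatives

section InteriorEstimates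

variable {D : ℕ}

theorem hasDerivAt_comp_line {f : (Fin D → ℝ) → ℝ} (hf : ContDiff ℝ ∞ f) (x v : Fin D → ℝ)
    (t : ℝ) : HasDerivAt (fun s : ℝ => f (x + s • v)) (∑ i, v i * pd i f (x + t • v)) t := by
  have h1 : HasDerivAt (fun s : ℝ => x + s • v) v t := by
    simpa using ((hasDerivAt_id t).smul_const v).const_add x
  have h2 := (hf.diffAt (x + t • v)).hasFDerivAt.comp_hasDerivAt t h1
  rwa [fderiv_apply_eq_sum_pd] at h2

theorem hasDerivAt_comp_single {f : (Fin D → ℝ) → ℝ} (hf : ContDiff ℝ ∞ f) (x : Fin D → ℝ)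
    (i : Fin D) (t : ℝ) :
    HasDerivAt (fun s : ℝ => f (x + s • (Pi.single i 1 : Fin D → ℝ)))
      (pd i f (x + t • (Pi.single i 1 : Fin D → ℝ))) t := by
  simpa [Pi.single_apply] using hasDerivAt_comp_line hf x (Pi.single i 1) t

theorem IsLocalMax.pd_pd_nonpos {w : (Fin D → ℝ) → ℝ} (hw : ContDiff ℝ ∞ w) {x : Fin D → ℝ}
    (hx : IsLocalMax w x) (i : Fin D) : pd i (pd i w) x ≤ 0 := by
  by_contra! hpos
  set e : Fin D → ℝ := Pi.single i 1
  set g : ℝ → ℝ := fun s => w (x + s • e) with hg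
  have hd : ∀ t, HasDerivAt g (pd i w (x + t • e)) t := hasDerivAt_comp_single hw x i
  have hdg : deriv g = fun t => pd i w (x + t • e) := funext fun t => (hd t).deriv
  have hddg : deriv (deriv g) 0 = pd i (pd i w) x := by
    rw [hdg, (hasDerivAt_comp_single (hw.pd i) x i 0).deriv]; simp
  have hc : Continuous fun s : ℝ => x + s • e := by fun_prop
  have hmax : IsLocalMax g 0 := by
    have : Tendsto (fun s : ℝ => x + s • e) (𝓝 0) (𝓝 x) := by
      simpa using hc.tendsto 0
    have h := this.eventually hx
    change ∀ᶠ s in 𝓝 0, g s ≤ g 0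
    filter_upwards [h] with s hs
    simpa [hg] using hs
  have hmin : IsLocalMin g 0 :=
    isLocalMin_of_deriv_deriv_pos (by rw [hddg]; exact hpos) hmax.deriv_eq_zero
      (hd 0).continuousAt
  have heq : g =ᶠ[𝓝 0] fun _ => g 0 := by
    filter_upwards [hmax, hmin] with s h1 h2 using le_antisymm h1 h2
  have := heq.deriv.deriv_eq
  rw [hddg] at this
  simp at this
  exact hpos.ne' this

theorem IsLocalMax.lap_nonpos {w : (Fin D → ℝ) → ℝ} (hw : ContDiff ℝ ∞ w) {x : Fin D → ℝ}
    (hx : IsLocalMax w x) : lap w x ≤ 0 :=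
  Finset.sum_nonpos fun i _ => hx.pd_pd_nonpos hw i

theorem pd_comp_clm {f : (Fin D → ℝ) → ℝ} (hf : ContDiff ℝ ∞ f)
    (A : (Fin D → ℝ) →L[ℝ] (Fin D → ℝ)) (b : Fin D → ℝ) (i : Fin D) :
    pd i (fun x => f (b + A x)) = fun x => ∑ j, A (Pi.single i 1) j * pd j f (b + A x) := by
  funext x
  have h1 : HasFDerivAt (fun x => b + A x) A x := A.hasFDerivAt.const_add b
  have h2 := (hf.diffAt (b + A x)).hasFDerivAt.comp x h1
  change fderiv ℝ (f ∘ fun x => b + A x) x (Pi.single i 1) = _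
  rw [h2.fderiv, ContinuousLinearMap.comp_apply, fderiv_apply_eq_sum_pd]

theorem pd_comp_add {f : (Fin D → ℝ) → ℝ} (hf : ContDiff ℝ ∞ f) (b : Fin D → ℝ) (i : Fin D) :
    pd i (fun x => f (b + x)) = fun x => pd i f (b + x) := by
  simpa [Pi.single_apply] using pd_comp_clm hf (ContinuousLinearMap.id ℝ _) b i

theorem lap_comp_add {f : (Fin D → ℝ) → ℝ} (hf : ContDiff ℝ ∞ f) (b : Fin D → ℝ) :
    lap (fun x => f (b + x)) = fun x => lap f (b + x) := by
  funext x
  simp [lap, pd_comp_add hf, pd_comp_add (hf.pd _)]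

/-- The reflection in the `i`-th coordinate hyperplane. -/
noncomputable def coordReflection (i : Fin D) : (Fin D → ℝ) →L[ℝ] (Fin D → ℝ) :=
  ContinuousLinearMap.pi fun j => (if j = i then (-1 : ℝ) else 1) • ContinuousLinearMap.proj j

theorem coordReflection_apply (i j : Fin D) (x : Fin D → ℝ) :
    coordReflection i x j = (if j = i then (-1 : ℝ) else 1) * x j := rfl

theorem norm_coordReflection (i : Fin D) (x : Fin D → ℝ) : ‖coordReflection i x‖ = ‖x‖ := by
  have : ∀ j, ‖coordReflection i x j‖₊ = ‖x j‖₊ := by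
    intro j; rw [coordReflection_apply]; split_ifs <;> simp
  simp only [Pi.norm_def, this]

theorem pd_comp_reflection {f : (Fin D → ℝ) → ℝ} (hf : ContDiff ℝ ∞ f) (i j : Fin D) :
    pd j (fun x => f (coordReflection i x))
      = fun x => (if j = i then (-1 : ℝ) else 1) * pd j f (coordReflection i x) := by
  have h := pd_comp_clm hf (coordReflection i) 0 j
  simp only [zero_add] at h
  rw [h]
  funext x
  rw [Finset.sum_eq_single j]
  · simp [coordReflection_apply]
  · intro k _ hk
    simp [coordReflection_apply, hk]
  · simp

theorem lap_comp_reflection {f : (Fin D → ℝ) → ℝ} (hf : ContDiff ℝ ∞ f) (i : Fin D) :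
    lap (fun x => f (coordReflection i x)) = fun x => lap f (coordReflection i x) := by
  funext x
  refine Finset.sum_congr rfl fun j _ => ?_
  have hs : ContDiff ℝ ∞ fun x => pd j f (coordReflection i x) :=
    (hf.pd j).comp (coordReflection i).contDiff
  rw [pd_comp_reflection hf, pd_const_mul hs, pd_comp_reflection (hf.pd j)]
  split_ifs <;> simp

theorem contDiff_sum_sq : ContDiff ℝ ∞ (fun x : Fin D → ℝ => ∑ j, x j * x j) :=
  ContDiff.sum fun j _ => (contDiff_coord j).mul (contDiff_coord j)

theorem pd_sum_sq (i : Fin D) :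
    pd i (fun x : Fin D → ℝ => ∑ j, x j * x j) = fun x => 2 * x i := by
  rw [pd_sum fun j => (contDiff_coord j).mul (contDiff_coord j)]
  funext x
  simp only [pd_mul (contDiff_coord _) (contDiff_coord _), pd_coord]
  simp [Finset.sum_add_distrib]; ring

theorem lap_sum_sq : lap (fun x : Fin D → ℝ => ∑ j, x j * x j) = fun _ => 2 * (D : ℝ) := by
  funext x
  simp only [lap, pd_sum_sq, pd_const_mul (contDiff_coord _), pd_coord]
  simp; ring

theorem lap_coord_mul (i : Fin D) (d : ℝ) :
    lap (fun x : Fin D → ℝ => x i * (d - x i)) = fun _ => -2 := by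
  have h1 : ContDiff ℝ ∞ fun x : Fin D → ℝ => d - x i := contDiff_const.sub (contDiff_coord i)
  have h2 : ∀ k, pd k (fun x : Fin D → ℝ => x i * (d - x i))
      = fun x => (if i = k then 1 else 0) * (d - 2 * x i) := by
    intro k
    rw [pd_mul (contDiff_coord i) h1, pd_sub contDiff_const (contDiff_coord i), pd_coord, pd_const]
    funext x; ring
  have h3 : ContDiff ℝ ∞ fun x : Fin D → ℝ => d - 2 * x i :=
    contDiff_const.sub (contDiff_const.mul (contDiff_coord i))
  funext x
  simp only [lap, h2, pd_const_mul h3]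
  simp only [pd_sub contDiff_const (contDiff_const.mul (contDiff_coord i)), pd_const,
    pd_const_mul (contDiff_coord i), pd_coord]
  simp

theorem sq_norm_le_sum_sq (x : Fin D → ℝ) : ‖x‖ ^ 2 ≤ ∑ j, x j * x j := by
  have h0 : 0 ≤ ∑ j, x j * x j := Finset.sum_nonneg fun j _ => mul_self_nonneg _
  have : ‖x‖ ≤ √(∑ j, x j * x j) := by
    refine (pi_norm_le_iff_of_nonneg (Real.sqrt_nonneg _)).2 fun j => ?_
    rw [Real.norm_eq_abs]
    refine Real.abs_le_sqrt ?_
    rw [sq]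
    exact Finset.single_le_sum (f := fun j => x j * x j) (fun j _ => mul_self_nonneg _)
      (Finset.mem_univ j)
  calc ‖x‖ ^ 2 ≤ √(∑ j, x j * x j) ^ 2 := by gcongr
    _ = _ := Real.sq_sqrt h0

/-- One-sided gradient bound at the centre of a cube, with a strict bound on the Laplacian. -/
theorem pd_le_of_abs_lap_lt {u : (Fin D → ℝ) → ℝ} (hu : ContDiff ℝ ∞ u) {d M N : ℝ} (hd : 0 < d)
    (hM : ∀ x, ‖x‖ ≤ d → |u x| ≤ M) (hN : ∀ x, ‖x‖ ≤ d → |lap u x| < N) (i : Fin D) :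
    pd i u 0 ≤ D / d * M + d / 2 * N := by
  have hM0 : 0 ≤ M := (abs_nonneg _).trans (hM 0 (by simpa using hd.le))
  have hN0 : 0 < N := (abs_nonneg _).trans_lt (hN 0 (by simpa using hd.le))
  set c : ℝ := M * D / d ^ 2 + N / 2 with hc
  have hc0 : 0 ≤ c := by positivity
  set q : (Fin D → ℝ) → ℝ := fun x => ∑ j, x j * x j with hq
  set ur : (Fin D → ℝ) → ℝ := fun x => u (coordReflection i x) with hur
  have hurs : ContDiff ℝ ∞ ur := hu.comp (coordReflection i).contDiff
  have hb : ContDiff ℝ ∞ fun x : Fin D → ℝ => x i * (d - x i) :=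
    (contDiff_coord i).mul (contDiff_const.sub (contDiff_coord i))
  set φ : (Fin D → ℝ) → ℝ := fun x => 1 / 2 * (u x - ur x) with hφ
  set ψ : (Fin D → ℝ) → ℝ := fun x => M / d ^ 2 * q x + c * (x i * (d - x i)) with hψ
  have hφs : ContDiff ℝ ∞ φ := contDiff_const.mul (hu.sub hurs)
  have hψs : ContDiff ℝ ∞ ψ :=
    (contDiff_const.mul contDiff_sum_sq).add (contDiff_const.mul hb)
  have hlφ : ∀ x, lap φ x = 1 / 2 * (lap u x - lap u (coordReflection i x)) := by
    intro x
    rw [hφ, lap_const_mul (hu.sub hurs), lap_sub hu hurs, hur, lap_comp_reflection hu]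
  have hlψ : ∀ x, lap ψ x = -N := by
    intro x
    rw [hψ, lap_add (contDiff_const.mul contDiff_sum_sq) (contDiff_const.mul hb),
      lap_const_mul contDiff_sum_sq, lap_const_mul hb, lap_sum_sq, lap_coord_mul, hc]
    ring
  set w : (Fin D → ℝ) → ℝ := fun x => φ x - ψ x with hw
  have hws : ContDiff ℝ ∞ w := hφs.sub hψs
  have hlw : ∀ x, ‖x‖ ≤ d → 0 < lap w x := by
    intro x hx
    rw [hw, lap_sub hφs hψs]
    beta_reduce
    rw [hlφ, hlψ]
    have h1 := abs_lt.1 (hN x hx)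
    have h2 := abs_lt.1 (hN (coordReflection i x) (by rwa [norm_coordReflection]))
    linarith [h1.1, h2.2]
  have hφM : ∀ x, ‖x‖ ≤ d → φ x ≤ M := by
    intro x hx
    have h1 := abs_le.1 (hM x hx)
    have h2 := abs_le.1 (hM (coordReflection i x) (by rwa [norm_coordReflection]))
    simp only [hφ, hur]; linarith [h1.2, h2.1]
  have hq0 : ∀ x, 0 ≤ q x := fun x => Finset.sum_nonneg fun j _ => mul_self_nonneg _
  set K : Set (Fin D → ℝ) := Metric.closedBall 0 d ∩ {x | 0 ≤ x i} with hK
  have hKc : IsCompact K :=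
    (isCompact_closedBall _ _).inter_right (isClosed_le continuous_const (continuous_apply i))
  have hle : ∀ x ∈ K, w x ≤ 0 := by
    obtain ⟨z, hzK, hz⟩ := hKc.exists_isMaxOn ⟨0, by simp [hK, hd.le]⟩ hws.continuous.continuousOn
    suffices w z ≤ 0 from fun x hx => (hz hx).trans this
    have hzd : ‖z‖ ≤ d := by simpa using hzK.1
    have hzi : 0 ≤ z i := hzK.2
    have hzi' : z i ≤ d := ((le_abs_self _).trans (norm_le_pi_norm z i)).trans hzd
    have hbn : 0 ≤ c * (z i * (d - z i)) := mul_nonneg hc0 (mul_nonneg hzi (by linarith))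
    rcases hzi.eq_or_lt with h0 | h0
    · have hr : coordReflection i z = z := by
        funext j; rw [coordReflection_apply]; split_ifs with h
        · subst h; rw [← h0]; simp
        · simp
      have : 0 ≤ M / d ^ 2 * q z := mul_nonneg (by positivity) (hq0 z)
      simp only [hw, hφ, hψ, hur, hr]; linarith
    rcases hzd.eq_or_lt with h1 | h1
    · have h2 : M ≤ M / d ^ 2 * q z := by
        have := sq_norm_le_sum_sq z
        rw [h1] at this
        calc M = M / d ^ 2 * d ^ 2 := by field_simp
          _ ≤ _ := by gcongr
      have := hφM z hzd
      simp only [hw, hψ]; linarith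
    · exfalso
      have hnhds : K ∈ 𝓝 z := by
        refine inter_mem ?_ ?_
        · exact Metric.closedBall_mem_nhds_of_mem (by simpa using h1)
        · filter_upwards [(continuous_apply i).continuousAt.eventually (lt_mem_nhds h0)] with y hy
          exact le_of_lt hy
      have hloc : IsLocalMax w z := hz.isLocalMax hnhds
      exact absurd (hloc.lap_nonpos hws) (not_le.2 (hlw z hzd))
  set e : Fin D → ℝ := Pi.single i 1 with he
  have hder : HasDerivAt (fun t : ℝ => w (0 + t • e)) (pd i w 0) 0 := by
    simpa using hasDerivAt_comp_single hws 0 i 0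
  have hpw : pd i w 0 = pd i u 0 - c * d := by
    have hψ' : pd i ψ 0 = c * d := by
      rw [hψ, pd_add (contDiff_const.mul contDiff_sum_sq) (contDiff_const.mul hb),
        pd_const_mul contDiff_sum_sq, pd_const_mul hb, pd_sum_sq,
        pd_mul (contDiff_coord i) (contDiff_const.sub (contDiff_coord i)), pd_coord]
      simp
    have hφ' : pd i φ 0 = pd i u 0 := by
      rw [hφ, pd_const_mul (hu.sub hurs), pd_sub hu hurs, hur, pd_comp_reflection hu]
      simp; ring
    rw [hw, pd_sub hφs hψs]
    simp only [hψ', hφ']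
  have hw0 : w 0 = 0 := by simp [hw, hφ, hψ, hur, hq]
  have hle0 : pd i w 0 ≤ 0 := by
    have ht := hder.hasDerivWithinAt (s := Ioi 0)
    rw [hasDerivWithinAt_iff_tendsto_slope' (by simp)] at ht
    refine le_of_tendsto ht ?_
    filter_upwards [Ioo_mem_nhdsGT hd] with t htt
    have hmem : 0 + t • e ∈ K := by
      refine ⟨?_, ?_⟩
      · simp [he, norm_smul, abs_of_pos htt.1, Pi.norm_single, htt.2.le]
      · simp [he, htt.1.le]
    have := hle _ hmem
    rw [slope_def_field]
    simp only [zero_smul, add_zero, hw0, sub_zero]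
    exact div_nonpos_of_nonpos_of_nonneg this htt.1.le
  rw [hpw] at hle0
  have : c * d = D / d * M + d / 2 * N := by rw [hc]; field_simp
  linarith

/-- Interior gradient estimate for Poisson's equation on a cube. -/
theorem abs_pd_le {u : (Fin D → ℝ) → ℝ} (hu : ContDiff ℝ ∞ u) {d M N : ℝ} (hd : 0 < d)
    (x₀ : Fin D → ℝ) (hM : ∀ x, ‖x - x₀‖ ≤ d → |u x| ≤ M)
    (hN : ∀ x, ‖x - x₀‖ ≤ d → |lap u x| ≤ N) (i : Fin D) :
    |pd i u x₀| ≤ D / d * M + d / 2 * N := by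
  have key : ∀ v : (Fin D → ℝ) → ℝ, ContDiff ℝ ∞ v → (∀ x, ‖x - x₀‖ ≤ d → |v x| ≤ M) →
      (∀ x, ‖x - x₀‖ ≤ d → |lap v x| ≤ N) → pd i v x₀ ≤ D / d * M + d / 2 * N := by
    intro v hv hM hN
    refine le_of_forall_pos_le_add fun ε hε => ?_
    have hvs : ContDiff ℝ ∞ fun x => v (x₀ + x) := hv.comp (contDiff_const.add contDiff_id)
    have := pd_le_of_abs_lap_lt (N := N + ε / d * 2) hvs hd (fun x hx => hM _ (by simpa))
      (fun x hx => by
        rw [lap_comp_add hv]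
        exact (hN _ (by simpa)).trans_lt (lt_add_of_pos_right _ (by positivity))) i
    rw [pd_comp_add hv] at this
    simp only [add_zero] at this
    refine this.trans (le_of_eq ?_)
    field_simp
    ring
  refine abs_le.2 ⟨?_, key u hu hM hN⟩
  have h1 : lap (fun x => - u x) = fun x => - lap u x := by
    simpa using lap_const_mul hu (-1)
  have := key (fun x => - u x) hu.neg (fun x hx => by rw [abs_neg]; exact hM x hx)
    (fun x hx => by rw [h1, abs_neg]; exact hN x hx)
  rw [pd_neg] at this
  linarith

end InteriorEstimates

section DerivativeBounds

variable {D : ℕ}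

theorem add_two_div_add_one_pow_le (k : ℕ) : (((k : ℝ) + 2) / (k + 1)) ^ k ≤ 3 := by
  have hk : (0 : ℝ) < k + 1 := by positivity
  have h1 : ((k : ℝ) + 2) / (k + 1) ≤ Real.exp (1 / (k + 1)) := by
    have := Real.add_one_le_exp (1 / ((k : ℝ) + 1))
    refine le_trans (le_of_eq ?_) this
    field_simp; ring
  calc (((k : ℝ) + 2) / (k + 1)) ^ k ≤ Real.exp (1 / (k + 1)) ^ k := by gcongr
    _ = Real.exp (k * (1 / (k + 1))) := by rw [← Real.exp_nat_mul]
    _ ≤ Real.exp 1 := by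
      gcongr
      rw [mul_one_div, div_le_one hk]; linarith
    _ ≤ 3 := Real.exp_one_lt_three.le

/-- Analytic-type bounds for all derivatives of `u`, from a bound of `u` and analytic-type bounds
for its Laplacian. -/
theorem abs_pds_le_of_lap {u : (Fin D → ℝ) → ℝ} (hu : ContDiff ℝ ∞ u) {R B N A L : ℝ}
    (hB0 : 0 ≤ B) (hN0 : 0 ≤ N) (hA0 : 0 ≤ A) (hL0 : 0 ≤ L) {x₀ : Fin D → ℝ}
    (hB : ∀ x, ‖x - x₀‖ ≤ R → |u x| ≤ B)
    (hF : ∀ (l : List (Fin D)) x, ‖x - x₀‖ ≤ R →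
      |pds l (lap u) x| ≤ N * A ^ l.length * l.length.factorial)
    (hAL : A * R ≤ L) (hBL : 6 * D * B + N * R ^ 2 ≤ B * L) (l : List (Fin D)) :
    ∀ s, 0 < s → s ≤ R → ∀ x, ‖x - x₀‖ ≤ R - s →
      |pds l u x| ≤ B * (L / s) ^ l.length * l.length.factorial := by
  induction l with
  | nil =>
    intro s hs _ x hx
    simpa using hB x (hx.trans (by linarith))
  | cons i l ih =>
    intro s hs hsR x hx
    set k := l.length with hk
    have hk1 : (0 : ℝ) < k + 1 := by positivity
    have hk2 : (0 : ℝ) < k + 2 := by positivity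
    set d : ℝ := s / (k + 2) with hd
    have hd0 : 0 < d := by positivity
    have hds : d ≤ s := div_le_self hs.le (by linarith)
    have hsd : s - d = s * ((k + 1) / (k + 2)) := by rw [hd]; field_simp; ring
    have hsd0 : 0 < s - d := by rw [hsd]; positivity
    have hM : ∀ y, ‖y - x‖ ≤ d → |pds l u y| ≤ B * (L / (s - d)) ^ k * k.factorial := by
      intro y hy
      refine ih (s - d) hsd0 (by linarith) y ?_
      calc ‖y - x₀‖ = ‖(y - x) + (x - x₀)‖ := by congr 1; abel
        _ ≤ ‖y - x‖ + ‖x - x₀‖ := norm_add_le _ _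
        _ ≤ _ := by linarith
    have hN : ∀ y, ‖y - x‖ ≤ d → |lap (pds l u) y| ≤ N * A ^ k * k.factorial := by
      intro y hy
      rw [← pds_lap hu]
      refine hF l y ?_
      calc ‖y - x₀‖ = ‖(y - x) + (x - x₀)‖ := by congr 1; abel
        _ ≤ ‖y - x‖ + ‖x - x₀‖ := norm_add_le _ _
        _ ≤ _ := by linarith
    have h := abs_pd_le (hu.pds l) hd0 x hM hN i
    have h3 : (L / (s - d)) ^ k ≤ 3 * (L / s) ^ k := by
      have : L / (s - d) = (k + 2) / (k + 1) * (L / s) := by rw [hsd]; field_simp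
      rw [this, mul_pow]
      have := add_two_div_add_one_pow_le k
      gcongr
    have hA : A ^ k ≤ (L / s) ^ k := by
      gcongr
      rw [le_div_iff₀ hs]
      exact (mul_le_mul_of_nonneg_left hsR hA0).trans hAL
    have hfac : ((l.length + 1).factorial : ℝ) = (k + 1) * k.factorial := by
      rw [Nat.factorial_succ]; push_cast; rfl
    have h1 : D / d * (B * (L / (s - d)) ^ k * k.factorial)
        ≤ 6 * D * B / s * (L / s) ^ k * ((k + 1) * k.factorial) := by
      calc D / d * (B * (L / (s - d)) ^ k * k.factorial)
          ≤ D / d * (B * (3 * (L / s) ^ k) * k.factorial) := by gcongr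
        _ = 3 * D * B / s * (L / s) ^ k * k.factorial * (k + 2) := by
          rw [hd]; field_simp
        _ ≤ 3 * D * B / s * (L / s) ^ k * k.factorial * (2 * (k + 1)) := by
          gcongr; linarith
        _ = _ := by ring
    have hR : 0 ≤ R := hs.le.trans hsR
    have h2 : d / 2 * (N * A ^ k * k.factorial)
        ≤ N * R ^ 2 / s * (L / s) ^ k * ((k + 1) * k.factorial) := by
      have : d / 2 ≤ R ^ 2 / s := by
        rw [le_div_iff₀ hs]
        calc d / 2 * s ≤ s * s := by gcongr; linarith
          _ ≤ R ^ 2 := by rw [sq]; gcongr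
      calc d / 2 * (N * A ^ k * k.factorial)
          ≤ R ^ 2 / s * (N * (L / s) ^ k * k.factorial) := by gcongr
        _ = N * R ^ 2 / s * (L / s) ^ k * (1 * k.factorial) := by ring
        _ ≤ _ := by gcongr; linarith
    rw [pds_cons, List.length_cons, hfac]
    calc |pd i (pds l u) x| ≤ _ := h
      _ ≤ 6 * D * B / s * (L / s) ^ k * ((k + 1) * k.factorial)
          + N * R ^ 2 / s * (L / s) ^ k * ((k + 1) * k.factorial) := add_le_add h1 h2
      _ = (6 * D * B + N * R ^ 2) * ((L / s) ^ k * ((k + 1) * k.factorial) / s) := by ring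
      _ ≤ (B * L) * ((L / s) ^ k * ((k + 1) * k.factorial) / s) := by gcongr
      _ = B * (L / s) ^ (k + 1) * ((k + 1) * k.factorial) := by rw [pow_succ]; ring

/-- Taylor's estimate for a sequence of functions, each the derivative of the previous one. -/
theorem abs_sub_taylor_sum_le (n : ℕ) : ∀ (φ : ℕ → ℝ → ℝ) (M : ℝ),
    (∀ k t, HasDerivAt (φ k) (φ (k + 1) t) t) → (∀ t ∈ Icc (0 : ℝ) 1, |φ n t| ≤ M) →
    ∀ t ∈ Icc (0 : ℝ) 1, |φ 0 t - ∑ k ∈ Finset.range n, φ k 0 * t ^ k / k.factorial|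
      ≤ M * t ^ n / n.factorial := by
  induction n with
  | zero => intro φ M _ hM t ht; simpa using hM t ht
  | succ n ih =>
    intro φ M hφ hM
    have hterm : ∀ (k : ℕ) (t : ℝ), HasDerivAt (fun t : ℝ => t ^ (k + 1) / (k + 1).factorial)
        (t ^ k / k.factorial) t := by
      intro k t
      have := (hasDerivAt_pow (k + 1) t).div_const ((k + 1).factorial : ℝ)
      refine this.congr_deriv ?_
      have hk : (k.factorial : ℝ) ≠ 0 := by positivity
      rw [Nat.factorial_succ, Nat.add_sub_cancel]; push_cast
      field_simp
    set g : ℝ → ℝ := fun t => φ 0 t - ∑ k ∈ Finset.range (n + 1), φ k 0 * t ^ k / k.factorial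
      with hg
    set g' : ℝ → ℝ := fun t => φ 1 t - ∑ k ∈ Finset.range n, φ (k + 1) 0 * t ^ k / k.factorial
      with hg'
    have hgd : ∀ t, HasDerivAt g (g' t) t := by
      intro t
      have h1 : HasDerivAt (fun t : ℝ => ∑ k ∈ Finset.range (n + 1), φ k 0 * t ^ k / k.factorial)
          (∑ k ∈ Finset.range n, φ (k + 1) 0 * t ^ k / k.factorial) t := by
        simp only [Finset.sum_range_succ', pow_zero, mul_one, Nat.factorial_zero, Nat.cast_one,
          div_one, mul_div_assoc]
        exact (HasDerivAt.fun_sum fun k _ => (hterm k t).const_mul _).add_const _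
      exact (hφ 0 t).sub h1
    have hbd : ∀ t ∈ Icc (0 : ℝ) 1, |g' t| ≤ M * t ^ n / n.factorial :=
      ih (fun k => φ (k + 1)) M (fun k t => hφ (k + 1) t) hM
    have hBd : ∀ t, HasDerivAt (fun t : ℝ => M * t ^ (n + 1) / (n + 1).factorial)
        (M * t ^ n / n.factorial) t := by
      intro t
      simpa only [mul_div_assoc] using (hterm n t).const_mul M
    intro t ht
    refine image_norm_le_of_norm_deriv_right_le_deriv_boundary (f := g) (f' := g') (a := 0) (b := 1)
      (fun t _ => (hgd t).continuousAt.continuousWithinAt) (fun t _ => (hgd t).hasDerivWithinAt)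
      ?_ hBd (fun t ht => hbd t ⟨ht.1, ht.2.le⟩) ht
    simp [hg, Finset.sum_range_succ']

/-- The `k`-th derivative of `f` at `y` applied to `k` copies of `x`. -/
noncomputable def dirDeriv : ℕ → ((Fin D → ℝ) → ℝ) → (Fin D → ℝ) → (Fin D → ℝ) → ℝ
  | 0, f, y, _ => f y
  | k + 1, f, y, x => ∑ i, x i * dirDeriv k (pd i f) y x

theorem hasDerivAt_dirDeriv (k : ℕ) : ∀ {f : (Fin D → ℝ) → ℝ}, ContDiff ℝ ∞ f →
    ∀ (y x : Fin D → ℝ) (t : ℝ), HasDerivAt (fun t : ℝ => dirDeriv k f (y + t • x) x)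
      (dirDeriv (k + 1) f (y + t • x) x) t := by
  induction k with
  | zero => intro f hf y x t; exact hasDerivAt_comp_line hf y x t
  | succ k ih =>
    intro f hf y x t
    exact HasDerivAt.fun_sum fun i _ => (ih (hf.pd i) y x t).const_mul _

theorem abs_dirDeriv_le (k : ℕ) : ∀ {f : (Fin D → ℝ) → ℝ} {y : Fin D → ℝ} {M : ℝ},
    (∀ l : List (Fin D), l.length = k → |pds l f y| ≤ M) → ∀ x,
    |dirDeriv k f y x| ≤ (D * ‖x‖) ^ k * M := by
  induction k with
  | zero => intro f y M h x; simpa [dirDeriv] using h [] rfl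
  | succ k ih =>
    intro f y M h x
    have h1 : ∀ i, |dirDeriv k (pd i f) y x| ≤ (D * ‖x‖) ^ k * M := fun i =>
      ih (fun l hl => by rw [← pds_append_singleton]; exact h _ (by simp [hl])) x
    calc |dirDeriv (k + 1) f y x| ≤ ∑ i, |x i * dirDeriv k (pd i f) y x| :=
          Finset.abs_sum_le_sum_abs _ _
      _ ≤ ∑ _i : Fin D, ‖x‖ * ((D * ‖x‖) ^ k * M) := by
          refine Finset.sum_le_sum fun i _ => ?_
          rw [abs_mul]
          exact mul_le_mul (norm_le_pi_norm x i) (h1 i) (abs_nonneg _) (norm_nonneg _)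
      _ = _ := by simp [pow_succ]; ring

theorem abs_sub_sum_dirDeriv_le {f : (Fin D → ℝ) → ℝ} (hf : ContDiff ℝ ∞ f) {x₀ : Fin D → ℝ}
    {B E r : ℝ} (h : ∀ (l : List (Fin D)) x, ‖x - x₀‖ ≤ r →
      |pds l f x| ≤ B * E ^ l.length * l.length.factorial) {x : Fin D → ℝ} (hx : ‖x‖ ≤ r) (n : ℕ) :
    |f (x₀ + x) - ∑ k ∈ Finset.range n, dirDeriv k f x₀ x / k.factorial|
      ≤ B * (E * (D * ‖x‖)) ^ n := by
  have h1 := abs_sub_taylor_sum_le n (fun k t => dirDeriv k f (x₀ + t • x) x)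
    ((D * ‖x‖) ^ n * (B * E ^ n * n.factorial)) (fun k t => hasDerivAt_dirDeriv k hf x₀ x t)
    (fun t ht => abs_dirDeriv_le n (fun l hl => by
      rw [← hl]
      refine h l _ ?_
      rw [add_sub_cancel_left, norm_smul, Real.norm_eq_abs, abs_of_nonneg ht.1]
      exact (mul_le_of_le_one_left (norm_nonneg _) ht.2).trans hx) x) 1 (by simp)
  simp only [one_smul, zero_smul, add_zero, one_pow, mul_one] at h1
  refine h1.trans (le_of_eq ?_)
  have : (n.factorial : ℝ) ≠ 0 := by positivity
  field_simp
  simp only [mul_pow]; ring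

/-- The `k`-th derivative of `f` at `y` as a continuous multilinear map. -/
noncomputable def multiDeriv : (k : ℕ) → ((Fin D → ℝ) → ℝ) → (Fin D → ℝ) →
    ContinuousMultilinearMap ℝ (fun _ : Fin k => Fin D → ℝ) ℝ
  | 0, f, y => ContinuousMultilinearMap.uncurry0 ℝ (Fin D → ℝ) (f y)
  | k + 1, f, y => ContinuousLinearMap.uncurryLeft
      (∑ i, (ContinuousLinearMap.proj (R := ℝ) (φ := fun _ : Fin D => ℝ) i).smulRight
        (multiDeriv k (pd i f) y))

theorem multiDeriv_apply_diag (k : ℕ) : ∀ (f : (Fin D → ℝ) → ℝ) (y x : Fin D → ℝ),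
    multiDeriv k f y (fun _ => x) = dirDeriv k f y x := by
  induction k with
  | zero => intro f y x; simp [multiDeriv, dirDeriv]
  | succ k ih =>
    intro f y x
    rw [multiDeriv, ContinuousLinearMap.uncurryLeft_apply]
    simp only [sum_apply, dirDeriv]
    refine Finset.sum_congr rfl fun i _ => ?_
    rw [← ih]; rfl

theorem norm_multiDeriv_le (k : ℕ) : ∀ {f : (Fin D → ℝ) → ℝ} {y : Fin D → ℝ} {M : ℝ}, 0 ≤ M →
    (∀ l : List (Fin D), l.length = k → |pds l f y| ≤ M) → ‖multiDeriv k f y‖ ≤ D ^ k * M := by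
  induction k with
  | zero =>
    intro f y M _ h
    have := h [] rfl
    simpa [multiDeriv] using this
  | succ k ih =>
    intro f y M hM h
    have h1 : ∀ i, ‖multiDeriv k (pd i f) y‖ ≤ D ^ k * M := fun i =>
      ih hM (fun l hl => by rw [← pds_append_singleton]; exact h _ (by simp [hl]))
    refine ContinuousMultilinearMap.opNorm_le_bound (by positivity) fun m => ?_
    have hm : multiDeriv (k + 1) f y m
        = ∑ i, m 0 i * multiDeriv k (pd i f) y (Fin.tail m) := by
      rw [multiDeriv, ContinuousLinearMap.uncurryLeft_apply]
      simp only [sum_apply]; rfl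
    rw [hm, Fin.prod_univ_succ]
    refine (norm_sum_le_of_le (n := fun _ : Fin D => ‖m 0‖ * (D ^ k * M * ∏ i : Fin k, ‖m i.succ‖))
      Finset.univ fun i _ => ?_).trans (le_of_eq ?_)
    · rw [norm_mul]
      gcongr
      · exact norm_le_pi_norm (m 0) i
      · exact ((multiDeriv k (pd i f) y).le_opNorm _).trans
          (mul_le_mul_of_nonneg_right (h1 i) (Finset.prod_nonneg fun _ _ => norm_nonneg _))
    · simp [pow_succ]; ring

/-- Factorial bounds of the derivatives near a point imply analyticity at that point. -/
theorem analyticAt_of_abs_pds_le {f : (Fin D → ℝ) → ℝ} (hf : ContDiff ℝ ∞ f) {x₀ : Fin D → ℝ}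
    {B E r : ℝ} (hr : 0 < r) (hE : 0 ≤ E) (h : ∀ (l : List (Fin D)) x, ‖x - x₀‖ ≤ r →
      |pds l f x| ≤ B * E ^ l.length * l.length.factorial) : AnalyticAt ℝ f x₀ := by
  set p : FormalMultilinearSeries ℝ (Fin D → ℝ) ℝ :=
    fun k => (1 / (k.factorial : ℝ)) • multiDeriv k f x₀ with hp
  have hB : 0 ≤ B := by
    have := (abs_nonneg _).trans (h [] x₀ (by simpa using hr.le)); simpa using this
  have hpn : ∀ k, ‖p k‖ ≤ B * (E * D) ^ k := by
    intro k
    have := norm_multiDeriv_le k (f := f) (y := x₀) (M := B * E ^ k * k.factorial)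
      (by positivity) (fun l hl => by rw [← hl]; exact h l x₀ (by simpa using hr.le))
    rw [hp, norm_smul, Real.norm_eq_abs, abs_of_nonneg (by positivity)]
    calc _ ≤ 1 / (k.factorial : ℝ) * (D ^ k * (B * E ^ k * k.factorial)) := by gcongr
      _ = _ := by
        have : (k.factorial : ℝ) ≠ 0 := by positivity
        field_simp
        rw [mul_pow]; ring
  set ρ : NNReal := ⟨min r (1 / (2 * (E * D + 1))), by positivity⟩ with hρ
  have hρr : (ρ : ℝ) ≤ r := min_le_left _ _
  have hρ0 : (0 : ℝ) < ρ := lt_min hr (by positivity)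
  have hEDρ : E * D * ρ ≤ 1 / 2 := by
    have h1 : (ρ : ℝ) ≤ 1 / (2 * (E * D + 1)) := min_le_right _ _
    calc E * D * ρ ≤ (E * D + 1) * (1 / (2 * (E * D + 1))) := by gcongr; linarith
      _ = 1 / 2 := by field_simp
  refine ⟨p, ρ, ?_, by exact_mod_cast hρ0, ?_⟩
  · refine p.le_radius_of_bound B fun k => ?_
    calc ‖p k‖ * (ρ : ℝ) ^ k ≤ B * (E * D) ^ k * (ρ : ℝ) ^ k := by gcongr; exact hpn k
      _ = B * (E * D * ρ) ^ k := by rw [mul_pow (E * D)]; ring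
      _ ≤ B * 1 := by gcongr; exact pow_le_one₀ (by positivity) (by linarith)
      _ = B := mul_one B
  · intro x hx
    have hxρ : ‖x‖ < ρ := by simpa using hx
    set q := E * (D * ‖x‖) with hq
    have hq0 : 0 ≤ q := by positivity
    have hq1 : q < 1 := by
      have : q ≤ E * D * ρ := by rw [hq, ← mul_assoc]; gcongr
      linarith
    have hdiag : ∀ k, p k (fun _ => x) = dirDeriv k f x₀ x / k.factorial := by
      intro k
      simp [hp, multiDeriv_apply_diag]; ring
    have hsn : Summable fun k => ‖p k (fun _ => x)‖ := by
      refine Summable.of_nonneg_of_le (fun _ => norm_nonneg _) (fun k => ?_)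
        ((summable_geometric_of_lt_one hq0 hq1).mul_left B)
      calc ‖p k (fun _ => x)‖ ≤ ‖p k‖ * ‖x‖ ^ k := by
            simpa using (p k).le_opNorm (fun _ => x)
        _ ≤ B * (E * D) ^ k * ‖x‖ ^ k := by gcongr; exact hpn k
        _ = _ := by rw [hq, ← mul_assoc, mul_pow (E * D)]; ring
    rw [hasSum_iff_tendsto_nat_of_summable_norm hsn]
    simp only [hdiag]
    rw [tendsto_iff_norm_sub_tendsto_zero]
    refine squeeze_zero (fun _ => norm_nonneg _) (fun n => ?_)
      (by simpa using (tendsto_pow_atTop_nhds_zero_of_lt_one hq0 hq1).const_mul B)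
    rw [norm_sub_rev, Real.norm_eq_abs]
    exact abs_sub_sum_dirDeriv_le hf h (hxρ.le.trans hρr) n

theorem pds_eq_iteratedFDeriv {f : (Fin D → ℝ) → ℝ} (hf : ContDiff ℝ ∞ f) (l : List (Fin D))
    (x : Fin D → ℝ) :
    pds l f x = iteratedFDeriv ℝ l.length f x (fun j => Pi.single (l.get j) 1) := by
  induction l generalizing x with
  | nil => simp
  | cons i l ih =>
    rw [pds_cons, funext ih]
    change fderiv ℝ (fun y => iteratedFDeriv ℝ l.length f y
      (fun j => Pi.single (l.get j) 1)) x (Pi.single i 1) = _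
    have hd : DifferentiableAt ℝ (iteratedFDeriv ℝ l.length f) x :=
      (hf.differentiable_iteratedFDeriv (m := l.length) (by exact_mod_cast WithTop.coe_lt_top _)) x
    have h2 : HasFDerivAt (fun y => iteratedFDeriv ℝ l.length f y
        (fun j => Pi.single (l.get j) 1))
        ((ContinuousMultilinearMap.apply ℝ (fun _ : Fin l.length => Fin D → ℝ) ℝ
          (fun j => Pi.single (l.get j) 1)).comp (fderiv ℝ (iteratedFDeriv ℝ l.length f) x)) x :=
      (ContinuousMultilinearMap.apply ℝ (fun _ : Fin l.length => Fin D → ℝ) ℝ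
          (fun j => Pi.single (l.get j) 1)).hasFDerivAt.comp x hd.hasFDerivAt
    rw [h2.fderiv]
    rfl

theorem NNReal.tsum_fiber_le {ι : Type*} {β : ι → Type*} {F : (Σ k, β k) → NNReal}
    (h : Summable F) (k : ι) : ∑' s, F ⟨k, s⟩ ≤ ∑' s, F s :=
  NNReal.tsum_comp_le_tsum_of_inj h sigma_mk_injective

theorem FormalMultilinearSeries.norm_changeOrigin_mul_le
    (p : FormalMultilinearSeries ℝ (Fin D → ℝ) ℝ) {ρ : NNReal}
    (hρ : (ρ : ENNReal) + ρ < p.radius) {y : Fin D → ℝ} (hy : ‖y‖₊ ≤ ρ) (k : ℕ) :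
    ‖p.changeOrigin y k‖₊ * ρ ^ k ≤ ∑' s : Σ k l : ℕ,
      { s : Finset (Fin (k + l)) // s.card = l }, ‖p (s.1 + s.2.1)‖₊ * ρ ^ s.2.1 * ρ ^ s.1 := by
  have hρ' : (ρ : ENNReal) < p.radius := lt_of_le_of_lt le_self_add hρ
  have hyr : (‖y‖₊ : ENNReal) < p.radius := lt_of_le_of_lt (by exact_mod_cast hy) hρ'
  refine le_trans ?_ (NNReal.tsum_fiber_le (p.changeOriginSeries_summable_aux₁ hρ) k)
  refine (mul_le_mul_left (p.nnnorm_changeOrigin_le k hyr) _).trans ?_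
  simp only [NNReal.tsum_mul_right]
  refine mul_le_mul_left ?_ _
  exact Summable.tsum_le_tsum (fun s => mul_le_mul_right (pow_le_pow_left' hy _) _)
    (p.changeOriginSeries_summable_aux₂ hyr k) (p.changeOriginSeries_summable_aux₂ hρ' k)

theorem FormalMultilinearSeries.exists_norm_changeOrigin_le
    (p : FormalMultilinearSeries ℝ (Fin D → ℝ) ℝ) (hp : 0 < p.radius) :
    ∃ ρ : NNReal, 0 < ρ ∧ (ρ : ENNReal) < p.radius ∧ ∃ S : ℝ, 0 ≤ S ∧
      ∀ y : Fin D → ℝ, ‖y‖₊ ≤ ρ → ∀ k, ‖p.changeOrigin y k‖ ≤ S * (1 / (ρ : ℝ)) ^ k := by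
  obtain ⟨r, hr0, hr⟩ := ENNReal.lt_iff_exists_nnreal_btwn.1 hp
  have hr0' : 0 < r := by exact_mod_cast hr0
  obtain ⟨ρ, hρ0, hρr⟩ : ∃ ρ : NNReal, 0 < ρ ∧ (ρ : ENNReal) + ρ < p.radius :=
    ⟨r / 2, by positivity, by rw [← ENNReal.coe_add, add_halves]; exact hr⟩
  obtain ⟨S, hS⟩ : ∃ S : NNReal, ∀ y : Fin D → ℝ, ‖y‖₊ ≤ ρ → ∀ k,
      ‖p.changeOrigin y k‖₊ * ρ ^ k ≤ S :=
    ⟨_, fun y hy k => p.norm_changeOrigin_mul_le hρr hy k⟩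
  refine ⟨ρ, hρ0, lt_of_le_of_lt le_self_add hρr, S, S.2, fun y hy k => ?_⟩
  have h3 : ‖p.changeOrigin y k‖ * (ρ : ℝ) ^ k ≤ S := by exact_mod_cast hS y hy k
  have hρ' : (0 : ℝ) < ρ := hρ0
  rw [one_div, inv_pow, ← div_eq_mul_inv, le_div_iff₀ (by positivity)]
  exact h3

/-- Local factorial bounds of the derivatives of an analytic function. -/
theorem exists_abs_pds_le_of_analytic {f : (Fin D → ℝ) → ℝ}
    (hf : AnalyticOnNhd ℝ f univ) (x₀ : Fin D → ℝ) :
    ∃ r B A : ℝ, 0 < r ∧ 0 ≤ B ∧ 0 ≤ A ∧ ∀ (l : List (Fin D)) x, ‖x - x₀‖ ≤ r →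
      |pds l f x| ≤ B * A ^ l.length * l.length.factorial := by
  obtain ⟨p, R, hp⟩ := hf x₀ (mem_univ _)
  obtain ⟨ρ, hρ0, hρr, S, hS, hb⟩ := p.exists_norm_changeOrigin_le (hp.r_pos.trans_le hp.r_le)
  obtain ⟨r, hr0, hr⟩ := ENNReal.lt_iff_exists_nnreal_btwn.1 hp.r_pos
  have hr0' : 0 < r := by exact_mod_cast hr0
  refine ⟨min r ρ, S, 1 / ρ, lt_min hr0' hρ0, hS, by positivity, fun l x hx => ?_⟩
  have hx1 : ‖x - x₀‖₊ ≤ r := by exact_mod_cast hx.trans (min_le_left _ _)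
  have hx2 : ‖x - x₀‖₊ ≤ ρ := by exact_mod_cast hx.trans (min_le_right _ _)
  have hpx := hp.changeOrigin (y := x - x₀) (lt_of_le_of_lt (by exact_mod_cast hx1) hr)
  rw [add_sub_cancel] at hpx
  have hcd : ContDiff ℝ ∞ f := contDiffOn_univ.1 (hf.contDiffOn uniqueDiffOn_univ)
  rw [pds_eq_iteratedFDeriv hcd, hpx.iteratedFDeriv_eq_sum hf.analyticOn]
  refine (Finset.abs_sum_le_sum_abs _ _).trans ?_
  have hterm : ∀ σ : Equiv.Perm (Fin l.length), |p.changeOrigin (x - x₀) l.length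
      (fun i => Pi.single (l.get (σ i)) 1)| ≤ S * (1 / (ρ : ℝ)) ^ l.length := by
    intro σ
    refine le_trans ((p.changeOrigin (x - x₀) l.length).le_opNorm _) ?_
    simp only [Pi.norm_single, norm_one, Finset.prod_const_one, mul_one]
    exact hb _ hx2 _
  refine (Finset.sum_le_sum fun σ _ => hterm σ).trans (le_of_eq ?_)
  simp [Finset.card_univ, Fintype.card_perm]; ring

/-- Elliptic regularity: a smooth function with analytic Laplacian is analytic. -/
theorem analyticOnNhd_of_lap {u : (Fin D → ℝ) → ℝ} (hu : ContDiff ℝ ∞ u)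
    (hf : AnalyticOnNhd ℝ (lap u) univ) : AnalyticOnNhd ℝ u univ := by
  intro x₀ _
  obtain ⟨R, N, A, hR, hN, hA, hF⟩ := exists_abs_pds_le_of_analytic hf x₀
  obtain ⟨B, hB⟩ := (isCompact_closedBall x₀ R).exists_bound_of_continuousOn
    hu.continuous.continuousOn
  have hB' : ∀ x, ‖x - x₀‖ ≤ R → |u x| ≤ |B| + 1 := fun x hx =>
    (hB x (by simpa [dist_eq_norm] using hx)).trans ((le_abs_self B).trans (by linarith))
  set L := 6 * D + N * R ^ 2 + A * R with hL
  have hL0 : 0 ≤ L := by positivity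
  have h := abs_pds_le_of_lap hu (B := |B| + 1) (by positivity) hN hA hL0 hB' hF
    (by have : 0 ≤ 6 * D + N * R ^ 2 := by positivity
        linarith)
    (by
      rw [hL]
      nlinarith [mul_nonneg (abs_nonneg B) (mul_nonneg hN (sq_nonneg R)),
        mul_nonneg (add_nonneg (abs_nonneg B) zero_le_one) (mul_nonneg hA hR.le)])
  refine analyticAt_of_abs_pds_le hu (r := R / 2) (by positivity) (E := L / (R / 2))
    (by positivity) (fun l x hx => h l (R / 2) (by positivity) (by linarith) x (by linarith))

end DerivativeBounds

section NewtonianPotential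

variable {D : ℕ}

theorem sum_sq_nonneg (z : Fin D → ℝ) : 0 ≤ ∑ j, z j * z j :=
  Finset.sum_nonneg fun j _ => mul_self_nonneg (z j)

/-- The kernel `|z|^(2 - D)`, up to normalization the fundamental solution of the Laplacian. -/
noncomputable def newtonKernel (z : Fin D → ℝ) : ℝ := (∑ j, z j * z j) ^ ((2 - (D : ℝ)) / 2)

theorem measurable_newtonKernel : Measurable (newtonKernel (D := D)) :=
  contDiff_sum_sq.continuous.measurable.pow_const _

theorem locallyIntegrable_newtonKernel (hD : 3 ≤ D) :
    LocallyIntegrable (newtonKernel (D := D)) := by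
  have hD' : (3 : ℝ) ≤ D := by exact_mod_cast hD
  refine locallyIntegrable_of_norm_le_rpow (C := 1) (α := D - 2) ?_ ?_ ?_
    measurable_newtonKernel.aestronglyMeasurable
  · rw [Module.finrank_fin_fun]; omega
  · rw [Module.finrank_fin_fun]; linarith
  · refine Eventually.of_forall fun z => ?_
    rw [Real.norm_eq_abs, newtonKernel, abs_of_nonneg (Real.rpow_nonneg (sum_sq_nonneg z) _),
      one_mul]
    rcases eq_or_ne z 0 with rfl | hz
    · simp only [Pi.zero_apply, mul_zero, Finset.sum_const_zero, norm_zero]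
      rw [Real.zero_rpow (by linarith)]
      exact Real.rpow_nonneg le_rfl _
    · have hz' : 0 < ‖z‖ := norm_pos_iff.2 hz
      calc (∑ j, z j * z j) ^ ((2 - (D : ℝ)) / 2) ≤ (‖z‖ ^ 2) ^ ((2 - (D : ℝ)) / 2) :=
            Real.rpow_le_rpow_of_nonpos (by positivity) (sq_norm_le_sum_sq z) (by linarith)
        _ = ‖z‖ ^ (-((D : ℝ) - 2)) := by
            rw [← Real.rpow_natCast, ← Real.rpow_mul hz'.le]
            congr 1; push_cast; ring

theorem pd_rpow {f : (Fin D → ℝ) → ℝ} (hf : ContDiff ℝ ∞ f) (h0 : ∀ x, f x ≠ 0) (p : ℝ)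
    (i : Fin D) : pd i (fun x => f x ^ p) = fun x => p * f x ^ (p - 1) * pd i f x := by
  funext x
  unfold pd
  rw [((hf.diffAt x).hasFDerivAt.rpow_const (p := p) (Or.inl (h0 x))).fderiv]
  rfl

theorem contDiff_sum_sq_add_rpow {c : ℝ} (hc : 0 < c) (p : ℝ) :
    ContDiff ℝ ∞ (fun z : Fin D → ℝ => (∑ j, z j * z j + c) ^ p) :=
  (contDiff_sum_sq.add contDiff_const).rpow_const_of_ne fun z => by
    have := sum_sq_nonneg z
    positivity

theorem pd_sum_sq_add_rpow {c : ℝ} (hc : 0 < c) (p : ℝ) (i : Fin D) :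
    pd i (fun z : Fin D → ℝ => (∑ j, z j * z j + c) ^ p)
      = fun z => 2 * p * (z i * (∑ j, z j * z j + c) ^ (p - 1)) := by
  rw [pd_rpow (contDiff_sum_sq.add contDiff_const) (fun z => by
    have := sum_sq_nonneg z
    positivity), pd_add contDiff_sum_sq contDiff_const, pd_sum_sq, pd_const]
  funext z; ring

theorem lap_sum_sq_add_rpow {c : ℝ} (hc : 0 < c) :
    lap (fun z : Fin D → ℝ => (∑ j, z j * z j + c) ^ ((2 - (D : ℝ)) / 2))
      = fun z => (2 - (D : ℝ)) * D * c * (∑ j, z j * z j + c) ^ ((2 - (D : ℝ)) / 2 - 2) := by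
  set p := (2 - (D : ℝ)) / 2 with hp
  have hDp : (D : ℝ) = 2 - 2 * p := by rw [hp]; ring
  funext z
  have hz : 0 < ∑ j, z j * z j + c := by have := sum_sq_nonneg z; positivity
  have h : ∀ i, pd i (pd i (fun z : Fin D → ℝ => (∑ j, z j * z j + c) ^ p)) z
      = 2 * p * (∑ j, z j * z j + c) ^ (p - 1)
        + 4 * p * (p - 1) * (∑ j, z j * z j + c) ^ (p - 2) * (z i * z i) := by
    intro i
    rw [pd_sum_sq_add_rpow hc, pd_const_mul ((contDiff_coord i).mul (contDiff_sum_sq_add_rpow hc _)),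
      pd_mul (contDiff_coord i) (contDiff_sum_sq_add_rpow hc _), pd_coord, pd_sum_sq_add_rpow hc]
    simp only [if_true]
    rw [show p - 1 - 1 = p - 2 by ring]; ring
  have h1 : (∑ j, z j * z j + c) ^ (p - 1) = (∑ j, z j * z j + c) ^ (p - 2) * (∑ j, z j * z j + c) := by
    rw [← Real.rpow_add_one hz.ne']; congr 1; ring
  unfold lap
  simp only [h, Finset.sum_add_distrib, ← Finset.mul_sum, Finset.sum_const, Finset.card_univ,
    Fintype.card_fin, nsmul_eq_mul]
  rw [h1, hDp]; ring

theorem HasCompactSupport.pd {f : (Fin D → ℝ) → ℝ} (hf : HasCompactSupport f) (i : Fin D) :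
    HasCompactSupport (pd i f) :=
  (hf.fderiv (𝕜 := ℝ)).comp_left (g := fun L : (Fin D → ℝ) →L[ℝ] ℝ => L (Pi.single i 1)) rfl

theorem HasCompactSupport.lap {f : (Fin D → ℝ) → ℝ} (hf : HasCompactSupport f) :
    HasCompactSupport (lap f) := by
  have : _root_.lap f = ∑ k, _root_.pd k (_root_.pd k f) := by funext x; simp [_root_.lap]
  rw [this]
  exact Finset.sum_induction _ HasCompactSupport (fun _ _ h1 h2 => h1.add h2)
    HasCompactSupport.zero fun k _ => (hf.pd k).pd k

theorem integrable_mul_of_hasCompactSupport {w g : (Fin D → ℝ) → ℝ} (hw : Continuous w)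
    (hg : Continuous g) (hc : HasCompactSupport g) : Integrable (fun x => w x * g x) :=
  (hw.mul hg).integrable_of_hasCompactSupport hc.mul_left

theorem integral_mul_pd {w g : (Fin D → ℝ) → ℝ} (hw : ContDiff ℝ ∞ w) (hg : ContDiff ℝ ∞ g)
    (hc : HasCompactSupport g) (i : Fin D) :
    ∫ x, w x * pd i g x = - ∫ x, pd i w x * g x :=
  integral_mul_fderiv_eq_neg_fderiv_mul_of_integrable
    (integrable_mul_of_hasCompactSupport (hw.pd i).continuous hg.continuous hc)
    (integrable_mul_of_hasCompactSupport hw.continuous (hg.pd i).continuous (hc.pd i))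
    (integrable_mul_of_hasCompactSupport hw.continuous hg.continuous hc)
    (fun x _ => hw.diffAt x) (fun x _ => hg.diffAt x)

theorem integral_mul_lap {w g : (Fin D → ℝ) → ℝ} (hw : ContDiff ℝ ∞ w) (hg : ContDiff ℝ ∞ g)
    (hc : HasCompactSupport g) : ∫ x, w x * lap g x = ∫ x, lap w x * g x := by
  unfold lap
  simp only [Finset.mul_sum, Finset.sum_mul]
  rw [integral_finsetSum _ fun i _ => integrable_mul_of_hasCompactSupport hw.continuous
      ((hg.pd i).pd i).continuous ((hc.pd i).pd i),
    integral_finsetSum _ fun i _ => integrable_mul_of_hasCompactSupport ((hw.pd i).pd i).continuous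
      hg.continuous hc]
  refine Finset.sum_congr rfl fun i _ => ?_
  rw [integral_mul_pd hw (hg.pd i) (hc.pd i), integral_mul_pd (hw.pd i) hg hc, neg_neg]

theorem integrable_one_add_sum_sq_rpow :
    Integrable (fun z : Fin D → ℝ => (∑ j, z j * z j + 1) ^ ((2 - (D : ℝ)) / 2 - 2)) := by
  have h := integrable_rpow_neg_one_add_norm_sq (E := Fin D → ℝ) (μ := volume) (r := D + 2)
    (by rw [Module.finrank_fin_fun]; linarith)
  refine h.mono' (contDiff_sum_sq_add_rpow one_pos _).continuous.aestronglyMeasurable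
    (Eventually.of_forall fun z => ?_)
  have := sum_sq_nonneg z
  rw [Real.norm_eq_abs, abs_of_nonneg (by positivity),
    show (2 - (D : ℝ)) / 2 - 2 = -(D + 2) / 2 by ring]
  refine Real.rpow_le_rpow_of_nonpos (by positivity) (by linarith [sq_norm_le_sum_sq z]) ?_
  have : (0 : ℝ) ≤ D := by positivity
  linarith

/-- The mass of the approximate identity obtained from the regularized Newtonian kernel. -/
noncomputable def newtonMass (D : ℕ) : ℝ :=
  ∫ z : Fin D → ℝ, (∑ j, z j * z j + 1) ^ ((2 - (D : ℝ)) / 2 - 2)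

theorem newtonMass_pos : 0 < newtonMass D := by
  refine integral_pos_of_integrable_nonneg_nonzero (x := 0)
    (contDiff_sum_sq_add_rpow one_pos _).continuous integrable_one_add_sum_sq_rpow
    (fun z => ?_) (by simp)
  have := sum_sq_nonneg z
  show 0 ≤ (∑ j, z j * z j + 1) ^ ((2 - (D : ℝ)) / 2 - 2)
  positivity

theorem integral_regularized_mul_lap {G : (Fin D → ℝ) → ℝ} (hG : ContDiff ℝ ∞ G)
    (hc : HasCompactSupport G) {ε : ℝ} (hε : 0 < ε) :
    ∫ z, (∑ j, z j * z j + ε ^ 2) ^ ((2 - (D : ℝ)) / 2) * lap G z = (2 - (D : ℝ)) * D *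
      ∫ y, (∑ j, y j * y j + 1) ^ ((2 - (D : ℝ)) / 2 - 2) * G (ε • y) := by
  have hε2 : 0 < ε ^ 2 := by positivity
  rw [integral_mul_lap (contDiff_sum_sq_add_rpow hε2 _) hG hc, lap_sum_sq_add_rpow hε2]
  have h := Measure.integral_comp_smul (volume : Measure (Fin D → ℝ)) (fun z : Fin D → ℝ =>
    (∑ j, z j * z j + ε ^ 2) ^ ((2 - (D : ℝ)) / 2 - 2) * G z) ε
  have h2 : ∀ y : Fin D → ℝ,
      (∑ j, (ε • y) j * (ε • y) j + ε ^ 2) ^ ((2 - (D : ℝ)) / 2 - 2) * G (ε • y)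
      = (ε ^ D * ε ^ 2)⁻¹ * ((∑ j, y j * y j + 1) ^ ((2 - (D : ℝ)) / 2 - 2) * G (ε • y)) := by
    intro y
    have hy := sum_sq_nonneg y
    have e1 : ∑ j, (ε • y) j * (ε • y) j + ε ^ 2 = ε ^ 2 * (∑ j, y j * y j + 1) := by
      simp only [Pi.smul_apply, smul_eq_mul]
      rw [mul_add, Finset.mul_sum, mul_one]
      congr 1
      exact Finset.sum_congr rfl fun j _ => by ring
    rw [e1, Real.mul_rpow hε2.le (by positivity), ← mul_assoc]
    congr 2
    rw [← Real.rpow_natCast ε 2, ← Real.rpow_mul hε.le, ← Real.rpow_natCast ε D,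
      ← Real.rpow_add hε, ← Real.rpow_neg hε.le]
    congr 1; push_cast; ring
  simp only [h2] at h
  rw [integral_const_mul, Module.finrank_fin_fun, smul_eq_mul, abs_of_pos (by positivity)] at h
  have hεD : ε ^ D ≠ 0 := by positivity
  have h3 : ∫ y, (∑ j, y j * y j + 1) ^ ((2 - (D : ℝ)) / 2 - 2) * G (ε • y)
      = ε ^ 2 * ∫ z, (∑ j, z j * z j + ε ^ 2) ^ ((2 - (D : ℝ)) / 2 - 2) * G z := by
    rw [mul_inv, mul_assoc] at h
    have h4 := mul_left_cancel₀ (inv_ne_zero hεD) h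
    rw [← h4, mul_inv_cancel_left₀ hε2.ne']
  rw [h3]
  simp only [mul_assoc]
  simp only [integral_const_mul]

theorem tendsto_integral_comp_smul {η G : (Fin D → ℝ) → ℝ} (hη : Integrable η) (hG : Continuous G)
    (hc : HasCompactSupport G) {ε : ℕ → ℝ} (hε : Tendsto ε atTop (𝓝 0)) :
    Tendsto (fun n => ∫ y, η y * G (ε n • y)) atTop (𝓝 (∫ y, η y * G 0)) := by
  obtain ⟨C, hC⟩ := hG.bounded_above_of_compact_support hc
  refine tendsto_integral_of_dominated_convergence (fun y => ‖η y‖ * C) (fun n => ?_)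
    (hη.norm.mul_const C) (fun n => Eventually.of_forall fun y => ?_)
    (Eventually.of_forall fun y => ?_)
  · exact hη.aestronglyMeasurable.mul
      (hG.comp (continuous_const_smul (ε n))).aestronglyMeasurable
  · rw [norm_mul]
    exact mul_le_mul_of_nonneg_left (hC _) (norm_nonneg _)
  · have : Tendsto (fun n => ε n • y) atTop (𝓝 0) := by simpa using hε.smul_const y
    exact ((hG.tendsto 0).comp this).const_mul _

theorem integrable_newtonKernel_mul (hD : 3 ≤ D) {g : (Fin D → ℝ) → ℝ} (hg : Continuous g)
    (hc : HasCompactSupport g) : Integrable (fun z => newtonKernel z * g z) := by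
  simpa [mul_comm] using
    (locallyIntegrable_newtonKernel hD).integrable_smul_left_of_hasCompactSupport hg hc

/-- The Newtonian kernel is a multiple of a fundamental solution of the Laplacian. -/
theorem integral_newtonKernel_mul_lap (hD : 3 ≤ D) {G : (Fin D → ℝ) → ℝ} (hG : ContDiff ℝ ∞ G)
    (hc : HasCompactSupport G) :
    ∫ z, newtonKernel z * lap G z = (2 - (D : ℝ)) * D * newtonMass D * G 0 := by
  have hD' : (3 : ℝ) ≤ D := by exact_mod_cast hD
  have : Nonempty (Fin D) := ⟨⟨0, by omega⟩⟩
  set ε : ℕ → ℝ := fun n => 1 / ((n : ℝ) + 1) with hε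
  have hε0 : ∀ n, 0 < ε n := fun n => by simp only [hε]; positivity
  have hεt : Tendsto ε atTop (𝓝 0) := tendsto_one_div_add_atTop_nhds_zero_nat
  have h1 : Tendsto (fun n => ∫ z, (∑ j, z j * z j + ε n ^ 2) ^ ((2 - (D : ℝ)) / 2) * lap G z)
      atTop (𝓝 (∫ z, newtonKernel z * lap G z)) := by
    have hae : ∀ᵐ z : Fin D → ℝ, z ≠ 0 := Measure.ae_ne volume 0
    refine tendsto_integral_of_dominated_convergence (fun z => ‖newtonKernel z * lap G z‖)
      (fun n => ?_) (integrable_newtonKernel_mul hD hG.lap.continuous hc.lap).norm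
      (fun n => ?_) ?_
    · exact ((contDiff_sum_sq_add_rpow (by have := hε0 n; positivity) _).mul
        hG.lap).continuous.aestronglyMeasurable
    · filter_upwards [hae] with z hz
      have hq : 0 < ∑ j, z j * z j :=
        (by have := norm_pos_iff.2 hz; positivity : 0 < ‖z‖ ^ 2).trans_le (sq_norm_le_sum_sq z)
      rw [norm_mul, norm_mul, newtonKernel, Real.norm_eq_abs, Real.norm_eq_abs (_ ^ _),
        abs_of_pos (by positivity), abs_of_pos (by positivity)]
      refine mul_le_mul_of_nonneg_right ?_ (norm_nonneg _)
      exact Real.rpow_le_rpow_of_nonpos hq (by linarith [sq_nonneg (ε n)]) (by linarith)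
    · filter_upwards [hae] with z hz
      have hq : 0 < ∑ j, z j * z j :=
        (by have := norm_pos_iff.2 hz; positivity : 0 < ‖z‖ ^ 2).trans_le (sq_norm_le_sum_sq z)
      refine Tendsto.mul_const _ (Tendsto.rpow_const ?_ (Or.inl hq.ne'))
      simpa using (hεt.pow 2).const_add (∑ j, z j * z j)
  have h2 := (tendsto_integral_comp_smul (D := D) integrable_one_add_sum_sq_rpow hG.continuous hc
    hεt).const_mul ((2 - (D : ℝ)) * D)
  rw [integral_mul_const] at h2
  rw [tendsto_nhds_unique h1 (h2.congr fun n => (integral_regularized_mul_lap hG hc (hε0 n)).symm),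
    newtonMass]
  ring

theorem pd_comp_const_sub {g : (Fin D → ℝ) → ℝ} (hg : ContDiff ℝ ∞ g) (x : Fin D → ℝ) (i : Fin D) :
    pd i (fun t => g (x - t)) = fun t => -pd i g (x - t) := by
  funext t
  unfold pd
  have h : HasFDerivAt (fun t => g (x - t))
      ((fderiv ℝ g (x - t)).comp (-ContinuousLinearMap.id ℝ (Fin D → ℝ))) t :=
    (hg.diffAt (x - t)).hasFDerivAt.comp t ((hasFDerivAt_id t).const_sub x)
  rw [h.fderiv]; simp

theorem lap_comp_const_sub {g : (Fin D → ℝ) → ℝ} (hg : ContDiff ℝ ∞ g) (x : Fin D → ℝ) :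
    lap (fun t => g (x - t)) = fun t => lap g (x - t) := by
  funext t
  unfold lap
  refine Finset.sum_congr rfl fun i _ => ?_
  rw [pd_comp_const_sub hg, pd_neg, pd_comp_const_sub (hg.pd i)]
  exact neg_neg _

/-- The convolution of the Newtonian kernel with `g`. -/
noncomputable def newtonPotential (g : (Fin D → ℝ) → ℝ) : (Fin D → ℝ) → ℝ :=
  convolution newtonKernel g (ContinuousLinearMap.mul ℝ ℝ) volume

theorem ContDiff.newtonPotential (hD : 3 ≤ D) {g : (Fin D → ℝ) → ℝ} (hg : ContDiff ℝ ∞ g)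
    (hc : HasCompactSupport g) : ContDiff ℝ ∞ (newtonPotential g) :=
  hc.contDiff_convolution_right _ (locallyIntegrable_newtonKernel hD) hg

theorem pd_newtonPotential (hD : 3 ≤ D) {g : (Fin D → ℝ) → ℝ} (hg : ContDiff ℝ ∞ g)
    (hc : HasCompactSupport g) (i : Fin D) :
    pd i (newtonPotential g) = newtonPotential (pd i g) := by
  funext x
  have hg1 : ContDiff ℝ 1 g := hg.of_le (by exact_mod_cast le_top)
  have h := hc.hasFDerivAt_convolution_right (ContinuousLinearMap.mul ℝ ℝ)
    (locallyIntegrable_newtonKernel hD) hg1 x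
  change fderiv ℝ (newtonPotential g) x (Pi.single i 1) = _
  rw [newtonPotential, h.fderiv, convolution_precompR_apply _ (locallyIntegrable_newtonKernel hD)
    (hc.fderiv ℝ) (hg1.continuous_fderiv one_ne_zero)]
  rfl

theorem lap_newtonPotential (hD : 3 ≤ D) {g : (Fin D → ℝ) → ℝ} (hg : ContDiff ℝ ∞ g)
    (hc : HasCompactSupport g) (x : Fin D → ℝ) :
    lap (newtonPotential g) x = (2 - (D : ℝ)) * D * newtonMass D * g x := by
  have hGc : HasCompactSupport (fun t => g (x - t)) :=
    hc.comp_homeomorph (Homeomorph.subLeft x)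
  have hG : ContDiff ℝ ∞ (fun t => g (x - t)) := hg.comp (contDiff_const.sub contDiff_id)
  have h := integral_newtonKernel_mul_lap hD hG hGc
  rw [lap_comp_const_sub hg, sub_zero] at h
  rw [← h]
  unfold lap
  simp only [Finset.mul_sum]
  rw [integral_finsetSum]
  · refine Finset.sum_congr rfl fun i _ => ?_
    rw [pd_newtonPotential hD hg hc, pd_newtonPotential hD (hg.pd i) (hc.pd i)]
    rfl
  · intro i _
    exact integrable_newtonKernel_mul hD (((hg.pd i).pd i).continuous.comp
      (continuous_const.sub continuous_id)) (((hc.pd i).pd i).comp_homeomorph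
      (Homeomorph.subLeft x))

theorem exists_lap_eq_of_hasCompactSupport (hD : 3 ≤ D) {g : (Fin D → ℝ) → ℝ}
    (hg : ContDiff ℝ ∞ g) (hc : HasCompactSupport g) : ∃ u, ContDiff ℝ ∞ u ∧ lap u = g := by
  have hD' : (3 : ℝ) ≤ D := by exact_mod_cast hD
  have hc0 : (2 - (D : ℝ)) * D * newtonMass D ≠ 0 :=
    mul_ne_zero (mul_ne_zero (by linarith) (by linarith)) newtonMass_pos.ne'
  refine ⟨fun x => ((2 - (D : ℝ)) * D * newtonMass D)⁻¹ * newtonPotential g x,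
    contDiff_const.mul (hg.newtonPotential hD hc), ?_⟩
  rw [lap_const_mul (hg.newtonPotential hD hc)]
  funext x
  rw [lap_newtonPotential hD hg hc, inv_mul_cancel_left₀ hc0]

end NewtonianPotential

section HarmonicPolynomials

variable {D : ℕ}

theorem contDiff_dirDeriv (k : ℕ) : ∀ (f : (Fin D → ℝ) → ℝ) (y : Fin D → ℝ),
    ContDiff ℝ ∞ (dirDeriv k f y) := by
  induction k with
  | zero => intro f y; exact contDiff_const
  | succ k ih => intro f y; exact ContDiff.sum fun i _ => (contDiff_coord i).mul (ih (pd i f) y)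

theorem pd_dirDeriv_succ (k : ℕ) : ∀ {f : (Fin D → ℝ) → ℝ}, ContDiff ℝ ∞ f →
    ∀ (y : Fin D → ℝ) (j : Fin D),
    pd j (dirDeriv (k + 1) f y) = fun x => (k + 1) * dirDeriv k (pd j f) y x := by
  induction k with
  | zero =>
    intro f hf y j
    change pd j (fun x => ∑ i, x i * pd i f y) = _
    rw [pd_sum fun i => (contDiff_coord i).mul contDiff_const]
    funext x
    simp only [pd_mul (contDiff_coord _) contDiff_const, pd_coord, pd_const]
    simp [dirDeriv]
  | succ k ih =>
    intro f hf y j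
    change pd j (fun x => ∑ i, x i * dirDeriv (k + 1) (pd i f) y x) = _
    rw [pd_sum fun i => (contDiff_coord i).mul (contDiff_dirDeriv _ _ _)]
    funext x
    simp only [pd_mul (contDiff_coord _) (contDiff_dirDeriv _ _ _), pd_coord, ih (hf.pd _),
      pd_comm hf j, Finset.sum_add_distrib, ite_mul, one_mul, zero_mul, Finset.sum_ite_eq',
      Finset.mem_univ, if_true]
    rw [show dirDeriv (k + 1) (pd j f) y x = ∑ i, x i * dirDeriv k (pd i (pd j f)) y x from rfl]
    push_cast
    rw [add_mul _ (1 : ℝ), Finset.mul_sum, one_mul, add_comm]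
    congr 1
    refine Finset.sum_congr rfl fun i _ => ?_
    rw [pd_comm hf i j]; ring

theorem dirDeriv_sum (k : ℕ) {ι : Type*} (s : Finset ι) : ∀ {f : ι → (Fin D → ℝ) → ℝ},
    (∀ a, ContDiff ℝ ∞ (f a)) → ∀ y x : Fin D → ℝ,
    dirDeriv k (fun z => ∑ a ∈ s, f a z) y x = ∑ a ∈ s, dirDeriv k (f a) y x := by
  induction k with
  | zero => intro f hf y x; rfl
  | succ k ih =>
    intro f hf y x
    simp only [dirDeriv, pd_sum hf, ih fun a => (hf a).pd _, Finset.mul_sum]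
    exact Finset.sum_comm

theorem dirDeriv_congr_of_eventuallyEq (k : ℕ) : ∀ {f g : (Fin D → ℝ) → ℝ} {y : Fin D → ℝ},
    f =ᶠ[𝓝 y] g → ∀ x, dirDeriv k f y x = dirDeriv k g y x := by
  induction k with
  | zero => intro f g y h x; exact h.eq_of_nhds
  | succ k ih =>
    intro f g y h x
    simp only [dirDeriv, ih (pd_congr_of_eventuallyEq h _)]

theorem dirDeriv_zero (k : ℕ) : ∀ y x : Fin D → ℝ, dirDeriv k (fun _ => 0) y x = 0 := by
  induction k with
  | zero => intro y x; rfl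
  | succ k ih => intro y x; simp [dirDeriv, pd_const, ih]

/-- The Taylor terms of a function that is harmonic near the base point are harmonic. -/
theorem lap_dirDeriv_eq_zero {f : (Fin D → ℝ) → ℝ} (hf : ContDiff ℝ ∞ f) {y : Fin D → ℝ}
    (h : lap f =ᶠ[𝓝 y] fun _ => 0) : ∀ k, lap (dirDeriv k f y) = fun _ => 0
  | 0 => by
    funext x
    change ∑ j, pd j (pd j fun _ => f y) x = 0
    simp [pd_const]
  | 1 => by
    funext x
    change ∑ j, pd j (pd j (dirDeriv (0 + 1) f y)) x = 0
    refine Finset.sum_eq_zero fun j _ => ?_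
    rw [pd_dirDeriv_succ 0 hf]
    exact congrFun (pd_const j (((0 : ℕ) + 1 : ℝ) * pd j f y)) x
  | k + 2 => by
    funext x
    have h1 : ∀ j, pd j (pd j (dirDeriv (k + 1 + 1) f y)) x
        = ((k + 1 : ℕ) + 1) * ((k + 1) * dirDeriv k (pd j (pd j f)) y x) := by
      intro j
      rw [pd_dirDeriv_succ (k + 1) hf, pd_const_mul (contDiff_dirDeriv _ _ _),
        pd_dirDeriv_succ k (hf.pd j)]
    change ∑ j, pd j (pd j (dirDeriv (k + 1 + 1) f y)) x = 0
    simp only [h1, ← Finset.mul_sum]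
    rw [← dirDeriv_sum k Finset.univ fun j => (hf.pd j).pd j]
    have h2 : dirDeriv k (fun z => ∑ j, pd j (pd j f) z) y x = 0 :=
      (dirDeriv_congr_of_eventuallyEq k h x).trans (dirDeriv_zero k y x)
    rw [h2]; simp

theorem pds_eq_zero_of_mem_ball {f : (Fin D → ℝ) → ℝ} {R : ℝ} (h : ∀ x, ‖x‖ < R → f x = 0)
    (l : List (Fin D)) {x : Fin D → ℝ} (hx : ‖x‖ < R) : pds l f x = 0 := by
  have : f =ᶠ[𝓝 x] fun _ => 0 := by
    filter_upwards [(isOpen_lt continuous_norm continuous_const).mem_nhds hx] with y hy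
    exact h y hy
  rw [(pds_congr_of_eventuallyEq this l).eq_of_nhds, pds_zero]

/-- Interior derivative estimates for harmonic functions. -/
theorem abs_pds_le_of_harmonic {h : (Fin D → ℝ) → ℝ} (hh : ContDiff ℝ ∞ h) {R R' B : ℝ}
    (hR : 0 < R) (hR' : R < R') (h0 : ∀ x, ‖x‖ < R' → lap h x = 0)
    (hB : ∀ x, ‖x‖ ≤ R → |h x| ≤ B) (l : List (Fin D)) {x : Fin D → ℝ} (hx : ‖x‖ ≤ R / 2) :
    |pds l h x| ≤ B * (6 * D / (R / 2)) ^ l.length * l.length.factorial := by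
  have hB0 : 0 ≤ B := (abs_nonneg _).trans (hB 0 (by simpa using hR.le))
  exact abs_pds_le_of_lap hh (x₀ := 0) (R := R) (N := 0) (A := 0) hB0 le_rfl le_rfl
    (by positivity) (by simpa using hB)
    (fun l x hx => by
      rw [sub_zero] at hx
      rw [pds_eq_zero_of_mem_ball h0 l (hx.trans_lt hR')]; simp)
    (by simp) (le_of_eq (by ring)) l (R / 2) (by positivity) (by linarith) x
    (by rw [sub_zero]; linarith)

/-- A function harmonic in a ball is approximated by entire harmonic functions in a smaller
ball. -/
theorem exists_lap_eq_zero_approx {h : (Fin D → ℝ) → ℝ} (hh : ContDiff ℝ ∞ h) {R R' : ℝ}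
    (hR : 0 < R) (hR' : R < R') (h0 : ∀ x, ‖x‖ < R' → lap h x = 0) {ε : ℝ} (hε : 0 < ε) :
    ∃ p : (Fin D → ℝ) → ℝ, ContDiff ℝ ∞ p ∧ lap p = (fun _ => 0) ∧
      ∀ x, ‖x‖ ≤ R / (24 * D ^ 2 + 2) → |h x - p x| ≤ ε := by
  obtain ⟨B, hB⟩ := (isCompact_closedBall (0 : Fin D → ℝ) R).exists_bound_of_continuousOn
    hh.continuous.continuousOn
  have hB' : ∀ x, ‖x‖ ≤ R → |h x| ≤ B := fun x hx => hB x (by simpa using hx)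
  obtain ⟨n, hn⟩ : ∃ n : ℕ, B * (1 / 2 : ℝ) ^ n < ε :=
    (((tendsto_pow_atTop_nhds_zero_of_lt_one (by norm_num) (by norm_num :
      (1 / 2 : ℝ) < 1)).const_mul B).eventually_lt_const (by simpa using hε)).exists
  have hB0 : 0 ≤ B := (abs_nonneg _).trans (hB' 0 (by simpa using hR.le))
  have hev : lap h =ᶠ[𝓝 0] fun _ => 0 := by
    filter_upwards [Metric.ball_mem_nhds (0 : Fin D → ℝ) (hR.trans hR')] with y hy
    exact h0 y (by simpa using hy)
  refine ⟨fun x => ∑ k ∈ Finset.range n, (1 / (k.factorial : ℝ)) * dirDeriv k h 0 x,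
    ContDiff.sum fun k _ => contDiff_const.mul (contDiff_dirDeriv k h 0), ?_, fun x hx => ?_⟩
  · rw [lap_sum fun k => contDiff_const.mul (contDiff_dirDeriv k h 0)]
    funext x
    refine Finset.sum_eq_zero fun k _ => ?_
    rw [lap_const_mul (contDiff_dirDeriv k h 0), lap_dirDeriv_eq_zero hh hev]
    exact mul_zero _
  · have hx2 : ‖x‖ ≤ R / 2 := hx.trans (by
      gcongr
      have : (0 : ℝ) ≤ 24 * D ^ 2 := by positivity
      linarith)
    have h1 := abs_sub_sum_dirDeriv_le hh (x₀ := 0) (r := R / 2) (E := 6 * D / (R / 2)) (B := B)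
      (fun l x hx => abs_pds_le_of_harmonic hh hR hR' h0 hB' l (by simpa using hx)) hx2 n
    rw [zero_add] at h1
    have h2 : 6 * D / (R / 2) * (D * ‖x‖) ≤ 1 / 2 := by
      calc 6 * D / (R / 2) * (D * ‖x‖)
          ≤ 6 * D / (R / 2) * (D * (R / (24 * D ^ 2 + 2))) := by gcongr
        _ ≤ 1 / 2 := by
          have : (0 : ℝ) < 24 * D ^ 2 + 2 := by positivity
          rw [show 6 * D / (R / 2) * (D * (R / (24 * D ^ 2 + 2)))
            = 12 * (D : ℝ) ^ 2 / (24 * D ^ 2 + 2) by field_simp; ring, div_le_iff₀ this]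
          linarith
    calc |h x - ∑ k ∈ Finset.range n, (1 / (k.factorial : ℝ)) * dirDeriv k h 0 x|
        = |h x - ∑ k ∈ Finset.range n, dirDeriv k h 0 x / k.factorial| := by
          simp only [one_div_mul_eq_div]
      _ ≤ _ := h1
      _ ≤ B * (1 / 2) ^ n := by gcongr
      _ ≤ ε := hn.le

end HarmonicPolynomials

section SmoothSeries

variable {D : ℕ}

/-- Locally uniform absolute convergence of a series together with all its derivatives. -/
def LocallySummable (w : ℕ → (Fin D → ℝ) → ℝ) : Prop :=
  (∀ n, ContDiff ℝ ∞ (w n)) ∧ ∀ (l : List (Fin D)) (R : ℝ), ∃ b : ℕ → ℝ, Summable b ∧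
    ∀ n x, ‖x‖ ≤ R → |pds l (w n) x| ≤ b n

theorem LocallySummable.pd {w : ℕ → (Fin D → ℝ) → ℝ} (hw : LocallySummable w) (i : Fin D) :
    LocallySummable fun n => pd i (w n) :=
  ⟨fun n => (hw.1 n).pd i, fun l R => by
    obtain ⟨b, hb, h⟩ := hw.2 (l ++ [i]) R
    exact ⟨b, hb, fun n x hx => by rw [← pds_append_singleton]; exact h n x hx⟩⟩

theorem LocallySummable.summable {w : ℕ → (Fin D → ℝ) → ℝ} (hw : LocallySummable w)
    (x : Fin D → ℝ) : Summable fun n => w n x := by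
  obtain ⟨b, hb, h⟩ := hw.2 [] ‖x‖
  exact hb.of_norm_bounded fun n => h n x le_rfl

theorem norm_fderiv_le_sum_abs_pd (f : (Fin D → ℝ) → ℝ) (x : Fin D → ℝ) :
    ‖fderiv ℝ f x‖ ≤ ∑ i, |pd i f x| := by
  refine ContinuousLinearMap.opNorm_le_bound _ (Finset.sum_nonneg fun _ _ => abs_nonneg _)
    fun v => ?_
  rw [fderiv_apply_eq_sum_pd, Finset.sum_mul]
  refine norm_sum_le_of_le _ fun i _ => ?_
  rw [norm_mul, mul_comm, Real.norm_eq_abs (pd i f x)]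
  gcongr
  exact norm_le_pi_norm v i

theorem LocallySummable.hasFDerivAt {w : ℕ → (Fin D → ℝ) → ℝ} (hw : LocallySummable w)
    (x : Fin D → ℝ) : (Summable fun n => fderiv ℝ (w n) x) ∧
      HasFDerivAt (fun y => ∑' n, w n y) (∑' n, fderiv ℝ (w n) x) x := by
  choose b hb h using fun i => hw.2 [i] (‖x‖ + 1)
  have hbs : Summable fun n => ∑ i, b i n := summable_sum fun i _ => hb i
  have hx : x ∈ Metric.ball (0 : Fin D → ℝ) (‖x‖ + 1) := by simp
  have hbound : ∀ n y, y ∈ Metric.ball (0 : Fin D → ℝ) (‖x‖ + 1) →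
      ‖fderiv ℝ (w n) y‖ ≤ ∑ i, b i n := fun n y hy =>
    (norm_fderiv_le_sum_abs_pd _ _).trans
      (Finset.sum_le_sum fun i _ => h i n y (by simpa using (mem_ball_zero_iff.1 hy).le))
  exact ⟨hbs.of_norm_bounded fun n => hbound n x hx,
    hasFDerivAt_tsum_of_isPreconnected hbs Metric.isOpen_ball (convex_ball _ _).isPreconnected
      (fun n y _ => ((hw.1 n).diffAt y).hasFDerivAt) hbound hx (hw.summable x) hx⟩

theorem LocallySummable.pd_tsum {w : ℕ → (Fin D → ℝ) → ℝ} (hw : LocallySummable w) (i : Fin D) :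
    _root_.pd i (fun x => ∑' n, w n x) = fun x => ∑' n, _root_.pd i (w n) x := by
  funext x
  obtain ⟨hs, hd⟩ := hw.hasFDerivAt x
  change fderiv ℝ (fun x => ∑' n, w n x) x (Pi.single i 1) = _
  rw [hd.fderiv]
  exact (ContinuousLinearMap.apply ℝ ℝ (Pi.single i 1 : Fin D → ℝ)).map_tsum hs

theorem LocallySummable.contDiff_tsum {w : ℕ → (Fin D → ℝ) → ℝ} (hw : LocallySummable w) :
    ContDiff ℝ ∞ fun x => ∑' n, w n x := by
  refine contDiff_of_forall_pd
    (fun f => ∃ w : ℕ → (Fin D → ℝ) → ℝ, LocallySummable w ∧ f = fun x => ∑' n, w n x) ?_ ?_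
    ⟨w, hw, rfl⟩
  · rintro _ ⟨w, hw, rfl⟩ x
    exact (hw.hasFDerivAt x).2.differentiableAt
  · rintro _ ⟨w, hw, rfl⟩ i
    exact ⟨_, hw.pd i, hw.pd_tsum i⟩

theorem LocallySummable.lap_tsum {w : ℕ → (Fin D → ℝ) → ℝ} (hw : LocallySummable w) :
    lap (fun x => ∑' n, w n x) = fun x => ∑' n, lap (w n) x := by
  funext x
  unfold lap
  rw [Summable.tsum_finsetSum fun i _ => ((hw.pd i).pd i).summable x]
  refine Finset.sum_congr rfl fun i _ => ?_
  rw [hw.pd_tsum, (hw.pd i).pd_tsum]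

theorem locallySummable_of_eventually {w : ℕ → (Fin D → ℝ) → ℝ} (hw : ∀ n, ContDiff ℝ ∞ (w n))
    (h : ∀ (l : List (Fin D)) (R : ℝ), ∃ b : ℕ → ℝ, Summable b ∧
      ∀ᶠ n in atTop, ∀ x, ‖x‖ ≤ R → |pds l (w n) x| ≤ b n) : LocallySummable w := by
  refine ⟨hw, fun l R => ?_⟩
  obtain ⟨b, hb, hev⟩ := h l R
  obtain ⟨N, hN⟩ := eventually_atTop.1 hev
  choose C hC using fun n =>
    (isCompact_closedBall (0 : Fin D → ℝ) R).exists_bound_of_continuousOn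
      ((hw n).pds l).continuous.continuousOn
  refine ⟨fun n => if n < N then C n else b n, ?_, fun n x hx => ?_⟩
  · rw [← summable_nat_add_iff N]
    simpa using (summable_nat_add_iff N).2 hb
  · dsimp only
    split_ifs with hn
    · exact hC n x (by simpa using hx)
    · exact hN n (not_lt.1 hn) x hx

end SmoothSeries

section Surjectivity

variable {D : ℕ}

theorem exists_cutoff (f : (Fin D → ℝ) → ℝ) (hf : ContDiff ℝ ∞ f) (n : ℕ) :
    ∃ g : (Fin D → ℝ) → ℝ, ContDiff ℝ ∞ g ∧ HasCompactSupport g ∧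
      ∀ x, ‖x‖ ≤ n + 1 → g x = f x := by
  let χ : ContDiffBump (0 : Fin D → ℝ) := ⟨n + 1, n + 2, by positivity, by linarith⟩
  refine ⟨fun x => χ x * f x, χ.contDiff.mul hf, χ.hasCompactSupport.mul_right, fun x hx => ?_⟩
  change χ x * f x = f x
  rw [χ.one_of_mem_closedBall (by simpa using hx), one_mul]

/-- The Laplacian is surjective on smooth functions on `ℝ^D`, `D ≥ 3`. -/
theorem exists_lap_eq (hD : 3 ≤ D) {f : (Fin D → ℝ) → ℝ} (hf : ContDiff ℝ ∞ f) :
    ∃ u, ContDiff ℝ ∞ u ∧ lap u = f := by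
  choose g hg hgc hgf using exists_cutoff f hf
  choose u hu hug using fun n => exists_lap_eq_of_hasCompactSupport hD (hg n) (hgc n)
  set κ : ℝ := 24 * (D : ℝ) ^ 2 + 2 with hκ
  have hκ2 : 2 ≤ κ := by have : 0 ≤ 24 * (D : ℝ) ^ 2 := by positivity
                         linarith
  have hdiff : ∀ n x, lap (fun x => u (n + 1) x - u n x) x = g (n + 1) x - g n x := fun n x => by
    rw [lap_sub (hu _) (hu _), hug, hug]
  have hp : ∀ n : ℕ, ∃ p : (Fin D → ℝ) → ℝ, ContDiff ℝ ∞ p ∧ lap p = (fun _ => 0) ∧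
      ∀ x, ‖x‖ ≤ ((n : ℝ) + 1) / 2 / κ → |(u (n + 1) x - u n x) - p x| ≤ (1 / 2 : ℝ) ^ n := by
    intro n
    refine exists_lap_eq_zero_approx ((hu (n + 1)).sub (hu n)) (R := ((n : ℝ) + 1) / 2)
      (R' := n + 1) (by positivity) (by have : (0 : ℝ) ≤ n := by positivity
                                        linarith) (fun x hx => ?_) (by positivity)
    rw [hdiff, hgf n x hx.le, hgf (n + 1) x (by push_cast; linarith), sub_self]
  choose p hps hp0 hpb using hp
  set w : ℕ → (Fin D → ℝ) → ℝ := fun n x => (u (n + 1) x - u n x) - p n x with hw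
  have hws : ∀ n, ContDiff ℝ ∞ (w n) := fun n => ((hu _).sub (hu _)).sub (hps n)
  have hwl : ∀ n x, lap (w n) x = g (n + 1) x - g n x := fun n x => by
    rw [hw, lap_sub ((hu _).sub (hu _)) (hps n), hp0]
    change lap (fun x => u (n + 1) x - u n x) x - 0 = _
    rw [hdiff, sub_zero]
  have hsum : LocallySummable w := by
    refine locallySummable_of_eventually hws fun l R => ?_
    set M := |R| + 1 with hM
    have hM0 : 0 < M := by positivity
    refine ⟨fun n => (1 / 2 : ℝ) ^ n * (6 * D / (2 * M / 2)) ^ l.length * l.length.factorial,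
      ((summable_geometric_of_lt_one (by norm_num) (by norm_num)).mul_right _).mul_right _, ?_⟩
    filter_upwards [eventually_ge_atTop ⌈4 * M * κ⌉₊] with n hn x hx
    have hn' : 4 * M * κ ≤ n := (Nat.le_ceil _).trans (by exact_mod_cast hn)
    have hn2 : 2 * M ≤ ((n : ℝ) + 1) / 2 / κ := by
      rw [le_div_iff₀ (by linarith)]; linarith
    have hn3 : 2 * M < n + 1 := by nlinarith
    refine abs_pds_le_of_harmonic (hws n) (R := 2 * M) (R' := n + 1) (by positivity) hn3
      (fun y hy => ?_) (fun y hy => hpb n y (hy.trans hn2)) l ?_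
    · rw [hwl, hgf n y hy.le, hgf (n + 1) y (by push_cast; linarith), sub_self]
    · have := le_abs_self R
      linarith
  refine ⟨fun x => u 0 x + ∑' n, w n x, (hu 0).add hsum.contDiff_tsum, ?_⟩
  rw [lap_add (hu 0) hsum.contDiff_tsum, hsum.lap_tsum, hug]
  funext x
  simp only [hwl]
  set N := ⌈‖x‖⌉₊ with hN
  have hNx : ‖x‖ ≤ N := Nat.le_ceil _
  have hz : ∀ n ∉ Finset.range N, g (n + 1) x - g n x = 0 := by
    intro n hn
    have hn' : (N : ℝ) ≤ n := by exact_mod_cast not_lt.1 (by simpa using hn)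
    rw [hgf n x (by linarith), hgf (n + 1) x (by push_cast; linarith), sub_self]
  rw [tsum_eq_sum hz, Finset.sum_range_sub (fun n => g n x), hgf N x (by linarith)]
  ring

end Surjectivity

section RadialIntegral

variable {D : ℕ}

/-- The weighted radial average `x ↦ ∫₀¹ tⁿ f(tx) dt`. -/
noncomputable def radialIntegral (n : ℕ) (f : (Fin D → ℝ) → ℝ) : (Fin D → ℝ) → ℝ :=
  fun x => ∫ t in (0 : ℝ)..1, t ^ n * f (t • x)

theorem hasFDerivAt_radialIntegral {f : (Fin D → ℝ) → ℝ} (hf : ContDiff ℝ ∞ f) (n : ℕ)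
    (x₀ : Fin D → ℝ) : HasFDerivAt (radialIntegral n f)
      (∫ t in (0 : ℝ)..1, t ^ (n + 1) • fderiv ℝ f (t • x₀)) x₀ := by
  have hfd : Continuous (fderiv ℝ f) := (hf.fderiv_right (m := ∞) (by simp)).continuous
  have hfc := hf.continuous
  obtain ⟨C, hC⟩ := (isCompact_closedBall (0 : Fin D → ℝ) (‖x₀‖ + 1)).exists_bound_of_continuousOn
    hfd.continuousOn
  refine intervalIntegral.hasFDerivAt_integral_of_dominated_of_fderiv_le
    (F := fun x t => t ^ n * f (t • x)) (F' := fun x t => t ^ (n + 1) • fderiv ℝ f (t • x))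
    (bound := fun _ => C) (Metric.ball_mem_nhds x₀ one_pos) ?_ ?_ ?_ ?_ ?_ ?_
  · exact Eventually.of_forall fun x => Continuous.aestronglyMeasurable (by fun_prop)
  · exact Continuous.intervalIntegrable (by fun_prop) _ _
  · exact Continuous.aestronglyMeasurable (by fun_prop)
  · refine Eventually.of_forall fun t ht x hx => ?_
    rw [uIoc_of_le zero_le_one] at ht
    have hx' : ‖x‖ ≤ ‖x₀‖ + 1 := by
      have h1 := norm_le_norm_add_norm_sub' x x₀
      have h2 : ‖x - x₀‖ < 1 := by simpa [dist_eq_norm] using hx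
      linarith
    have htx : ‖t • x‖ ≤ ‖x₀‖ + 1 := by
      rw [norm_smul, Real.norm_of_nonneg ht.1.le]
      exact (mul_le_of_le_one_left (norm_nonneg _) ht.2).trans hx'
    rw [norm_smul, Real.norm_of_nonneg (pow_nonneg ht.1.le _)]
    exact (mul_le_of_le_one_left (norm_nonneg _) (pow_le_one₀ ht.1.le ht.2)).trans
      (hC _ (by simpa using htx))
  · exact intervalIntegrable_const
  · refine Eventually.of_forall fun t _ x _ => ?_
    have h1 : HasFDerivAt (fun x : Fin D → ℝ => t • x)
      (t • ContinuousLinearMap.id ℝ (Fin D → ℝ)) x := (hasFDerivAt_id x).const_smul t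
    have h2 := ((hf.diffAt (t • x)).hasFDerivAt.comp x h1).const_mul (t ^ n)
    refine h2.congr_fderiv ?_
    ext v
    simp [pow_succ, mul_assoc]

theorem pd_radialIntegral {f : (Fin D → ℝ) → ℝ} (hf : ContDiff ℝ ∞ f) (n : ℕ) (i : Fin D) :
    pd i (radialIntegral n f) = radialIntegral (n + 1) (pd i f) := by
  funext x
  have hfd : Continuous (fderiv ℝ f) := (hf.fderiv_right (m := ∞) (by simp)).continuous
  change fderiv ℝ (radialIntegral n f) x (Pi.single i 1) = _
  rw [(hasFDerivAt_radialIntegral hf n x).fderiv,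
    ContinuousLinearMap.intervalIntegral_apply (Continuous.intervalIntegrable (by fun_prop) _ _)]
  rfl

theorem ContDiff.radialIntegral {f : (Fin D → ℝ) → ℝ} (hf : ContDiff ℝ ∞ f) (n : ℕ) :
    ContDiff ℝ ∞ (radialIntegral n f) := by
  refine contDiff_of_forall_pd
    (fun g => ∃ (m : ℕ) (f : (Fin D → ℝ) → ℝ), ContDiff ℝ ∞ f ∧ g = _root_.radialIntegral m f)
    ?_ ?_ ⟨n, f, hf, rfl⟩
  · rintro _ ⟨m, f, hf, rfl⟩ x
    exact (hasFDerivAt_radialIntegral hf m x).differentiableAt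
  · rintro _ ⟨m, f, hf, rfl⟩ i
    exact ⟨m + 1, _root_.pd i f, hf.pd i, pd_radialIntegral hf m i⟩

theorem radialIntegral_sum {ι : Type*} {s : Finset ι} {f : ι → (Fin D → ℝ) → ℝ}
    (hf : ∀ a, ContDiff ℝ ∞ (f a)) (n : ℕ) (x : Fin D → ℝ) :
    radialIntegral n (fun y => ∑ a ∈ s, f a y) x = ∑ a ∈ s, radialIntegral n (f a) x := by
  have hfc := fun a => (hf a).continuous
  unfold radialIntegral
  rw [← intervalIntegral.integral_finsetSum fun a _ =>
    Continuous.intervalIntegrable (by have := hfc a; fun_prop) _ _]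
  simp only [Finset.mul_sum]

/-- The radial integral inverts the shifted Euler operator. -/
theorem euler_radialIntegral {f : (Fin D → ℝ) → ℝ} (hf : ContDiff ℝ ∞ f) (n : ℕ)
    (x : Fin D → ℝ) :
    ∑ k, x k * pd k (radialIntegral n f) x + (n + 1) * radialIntegral n f x = f x := by
  have hfc := hf.continuous
  have hpc := fun k => (hf.pd k).continuous
  have hd : ∀ t ∈ uIcc (0 : ℝ) 1, HasDerivAt (fun t : ℝ => t ^ (n + 1) * f (t • x))
      (∑ k, x k * (t ^ (n + 1) * pd k f (t • x)) + (n + 1) * (t ^ n * f (t • x))) t := by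
    intro t _
    have h1 := hasDerivAt_comp_line hf 0 x t
    simp only [zero_add] at h1
    refine ((hasDerivAt_pow (n + 1) t).mul h1).congr_deriv ?_
    have h2 : t ^ (n + 1) * ∑ k, x k * pd k f (t • x)
        = ∑ k, x k * (t ^ (n + 1) * pd k f (t • x)) := by
      rw [Finset.mul_sum]
      exact Finset.sum_congr rfl fun k _ => by ring
    rw [h2, Nat.add_sub_cancel]
    push_cast
    ring
  have hint : ∀ k, IntervalIntegrable (fun t : ℝ => x k * (t ^ (n + 1) * pd k f (t • x)))
      volume 0 1 := fun k =>
    Continuous.intervalIntegrable (by have := hpc k; fun_prop) _ _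
  have hint' : IntervalIntegrable (fun t : ℝ => ((n : ℝ) + 1) * (t ^ n * f (t • x)))
      volume 0 1 := Continuous.intervalIntegrable (by fun_prop) _ _
  have hs : IntervalIntegrable (fun t : ℝ => ∑ k, x k * (t ^ (n + 1) * pd k f (t • x)))
      volume 0 1 := Continuous.intervalIntegrable (by fun_prop) _ _
  have h := intervalIntegral.integral_eq_sub_of_hasDerivAt hd (hs.add hint')
  rw [intervalIntegral.integral_add hs hint',
    intervalIntegral.integral_finsetSum fun k _ => hint k] at h
  simp only [intervalIntegral.integral_const_mul] at h
  simp only [pd_radialIntegral hf]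
  simpa [radialIntegral] using h

end RadialIntegral

section Potential

variable {D : ℕ}

theorem radialIntegral_transverse {T : Fin D → (Fin D → ℝ) → ℝ} (hT : ∀ j, ContDiff ℝ ∞ (T j))
    (htrans : ∀ x, ∑ j, pd j (T j) x = 0) (n : ℕ) (x : Fin D → ℝ) :
    ∑ j, pd j (radialIntegral n (T j)) x = 0 := by
  simp only [pd_radialIntegral (hT _)]
  rw [← radialIntegral_sum fun j => (hT j).pd j]
  simp [htrans, radialIntegral]

theorem sum_pd_coord_mul_sub {V : Fin D → (Fin D → ℝ) → ℝ} (hV : ∀ i, ContDiff ℝ ∞ (V i))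
    (hdiv : ∀ x, ∑ k, pd k (V k) x = 0) (i : Fin D) (x : Fin D → ℝ) :
    ∑ k, pd k (fun x => x k * V i x - x i * V k x) x
      = ∑ k, x k * pd k (V i) x + ((D : ℝ) - 1) * V i x := by
  have h : ∀ k, pd k (fun x => x k * V i x - x i * V k x) x
      = V i x + x k * pd k (V i) x - ((if i = k then 1 else 0) * V k x + x i * pd k (V k) x) := by
    intro k
    rw [pd_sub ((contDiff_coord k).mul (hV i)) ((contDiff_coord i).mul (hV k)),
      pd_mul (contDiff_coord k) (hV i), pd_mul (contDiff_coord i) (hV k), pd_coord, pd_coord]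
    simp
  simp only [h, Finset.sum_sub_distrib, Finset.sum_add_distrib, ← Finset.mul_sum, hdiv]
  simp
  ring

theorem sum_pd_coord_mul {V : Fin D → (Fin D → ℝ) → ℝ} (hV : ∀ i, ContDiff ℝ ∞ (V i))
    (k : Fin D) (x : Fin D → ℝ) :
    ∑ l, pd l (fun x => x k * V l x) x = V k x + x k * ∑ l, pd l (V l) x := by
  simp [pd_mul (contDiff_coord k) (hV _), pd_coord, Finset.sum_add_distrib, Finset.mul_sum]

/-- A tensor with the symmetries of the Riemann tensor whose double divergence is recovered from
`T` by an Euler-type operator. -/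
def riemannProduct (T : Fin D → Fin D → (Fin D → ℝ) → ℝ) (i k j l : Fin D) :
    (Fin D → ℝ) → ℝ :=
  fun x => x k * (x l * T i j x - x j * T i l x) - x i * (x l * T k j x - x j * T k l x)

theorem sum_pd_riemannProduct {T : Fin D → Fin D → (Fin D → ℝ) → ℝ}
    (hT : ∀ i j, ContDiff ℝ ∞ (T i j)) (hsym : ∀ i j, T i j = T j i)
    (htrans : ∀ i x, ∑ j, pd j (T i j) x = 0) (i k j : Fin D) (x : Fin D → ℝ) :
    ∑ l, pd l (riemannProduct T i k j l) x
      = x k * (∑ m, x m * pd m (T i j) x + D * T i j x)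
        - x i * (∑ m, x m * pd m (T k j) x + D * T k j x) := by
  have hA : ∀ a l, ContDiff ℝ ∞ fun x => x l * T a j x - x j * T a l x := fun a l =>
    ((contDiff_coord l).mul (hT a j)).sub ((contDiff_coord j).mul (hT a l))
  unfold riemannProduct
  simp only [pd_sub ((contDiff_coord k).mul (hA i _)) ((contDiff_coord i).mul (hA k _)),
    Finset.sum_sub_distrib]
  rw [sum_pd_coord_mul (hA i), sum_pd_coord_mul (hA k), sum_pd_coord_mul_sub (hT i) (htrans i),
    sum_pd_coord_mul_sub (hT k) (htrans k), hsym k i]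
  ring

/-- A symmetric transverse tensor field has a symmetric transverse preimage under the
Laplacian. -/
theorem exists_transverse_lap_eq (hD : 3 ≤ D) {T : Fin D → Fin D → (Fin D → ℝ) → ℝ}
    (hT : ∀ i j, ContDiff ℝ ∞ (T i j)) (hsym : ∀ i j, T i j = T j i)
    (htrans : ∀ i x, ∑ j, pd j (T i j) x = 0) :
    ∃ u : Fin D → Fin D → (Fin D → ℝ) → ℝ, (∀ i j, ContDiff ℝ ∞ (u i j)) ∧
      (∀ i j, u i j = u j i) ∧ (∀ i x, ∑ j, pd j (u i j) x = 0) ∧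
      ∀ i j, lap (u i j) = T i j := by
  set S : Fin D → Fin D → (Fin D → ℝ) → ℝ := fun i j => radialIntegral (D - 2) (T i j) with hS
  have hSs : ∀ i j, ContDiff ℝ ∞ (S i j) := fun i j => (hT i j).radialIntegral _
  have hSsym : ∀ i j, S i j = S j i := fun i j => by simp only [hS, hsym i j]
  have hSt : ∀ i x, ∑ j, pd j (S i j) x = 0 := fun i =>
    radialIntegral_transverse (hT i) (htrans i) _
  have hSE : ∀ i j x, ∑ m, x m * pd m (S i j) x + ((D : ℝ) - 1) * S i j x = T i j x := by
    intro i j x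
    have h := euler_radialIntegral (hT i j) (D - 2) x
    rwa [Nat.cast_sub (by omega), show (D : ℝ) - (2 : ℕ) + 1 = D - 1 by push_cast; ring] at h
  set W : Fin D → Fin D → (Fin D → ℝ) → ℝ := fun i j => radialIntegral (D - 1) (S i j) with hW
  have hWs : ∀ i j, ContDiff ℝ ∞ (W i j) := fun i j => (hSs i j).radialIntegral _
  have hWsym : ∀ i j, W i j = W j i := fun i j => by simp only [hW, hSsym i j]
  have hWt : ∀ i x, ∑ j, pd j (W i j) x = 0 := fun i =>
    radialIntegral_transverse (hSs i) (hSt i) _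
  have hWE : ∀ i j x, ∑ m, x m * pd m (W i j) x + (D : ℝ) * W i j x = S i j x := by
    intro i j x
    have h := euler_radialIntegral (hSs i j) (D - 1) x
    rwa [Nat.cast_sub (by omega), show (D : ℝ) - (1 : ℕ) + 1 = D by push_cast; ring] at h
  choose! G hGs hGl using fun f : (Fin D → ℝ) → ℝ => exists_lap_eq (f := f) hD
  set Q : Fin D → Fin D → Fin D → Fin D → (Fin D → ℝ) → ℝ :=
    fun k l i j => fun x => x k * x l * W i j x with hQ
  have hQs : ∀ k l i j, ContDiff ℝ ∞ (Q k l i j) := fun k l i j =>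
    ((contDiff_coord k).mul (contDiff_coord l)).mul (hWs i j)
  have hQsym : ∀ k l i j, Q k l i j = Q l k j i := fun k l i j => by
    funext x; simp only [hQ, hWsym i j, mul_comm (x k)]
  have hGQ : ∀ k l i j, ContDiff ℝ ∞ (G (Q k l i j)) := fun k l i j => hGs _ (hQs k l i j)
  set L : Fin D → Fin D → Fin D → Fin D → (Fin D → ℝ) → ℝ := fun i k j l => fun x =>
    (G (Q k l i j) x - G (Q k j i l) x) - (G (Q i l k j) x - G (Q i j k l) x) with hL
  have hLs : ∀ i k j l, ContDiff ℝ ∞ (L i k j l) := fun i k j l =>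
    ((hGQ _ _ _ _).sub (hGQ _ _ _ _)).sub ((hGQ _ _ _ _).sub (hGQ _ _ _ _))
  have hLanti : ∀ i k j l, L i k j l = fun x => - L i k l j x := fun i k j l => by
    funext x; simp only [hL]; ring
  have hLpair : ∀ i k j l, L i k j l = L j l i k := fun i k j l => by
    funext x
    simp only [hL]
    rw [hQsym l k j i, hQsym l i j k, hQsym j k l i, hQsym j i l k]
    ring
  have hLl : ∀ i k j l, lap (L i k j l) = riemannProduct W i k j l := fun i k j l => by
    funext x
    simp only [hL]
    rw [lap_sub ((hGQ _ _ _ _).sub (hGQ _ _ _ _)) ((hGQ _ _ _ _).sub (hGQ _ _ _ _)),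
      lap_sub (hGQ _ _ _ _) (hGQ _ _ _ _), lap_sub (hGQ _ _ _ _) (hGQ _ _ _ _)]
    simp only [hGl _ (hQs _ _ _ _)]
    simp only [hQ, riemannProduct]
    ring
  have hLpp : ∀ i k j l a b, ContDiff ℝ ∞ (pd a (pd b (L i k j l))) := fun i k j l a b =>
    ((hLs i k j l).pd b).pd a
  refine ⟨fun i j x => ∑ k, ∑ l, pd k (pd l (L i k j l)) x,
    fun i j => ContDiff.sum fun k _ => ContDiff.sum fun l _ => hLpp _ _ _ _ _ _,
    fun i j => ?_, fun i x => ?_, fun i j => ?_⟩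
  · funext x
    change ∑ k, ∑ l, pd k (pd l (L i k j l)) x = ∑ l, ∑ k, pd l (pd k (L j l i k)) x
    rw [Finset.sum_comm]
    refine Finset.sum_congr rfl fun l _ => Finset.sum_congr rfl fun k _ => ?_
    rw [hLpair, pd_comm (hLs _ _ _ _)]
  · have h1 : ∀ j, pd j (fun x => ∑ k, ∑ l, pd k (pd l (L i k j l)) x) x
        = ∑ k, ∑ l, pd j (pd k (pd l (L i k j l))) x := fun j => by
      rw [pd_sum fun k => ContDiff.sum fun l _ => hLpp _ _ _ _ _ _]
      simp only [pd_sum fun l => hLpp _ _ _ _ _ _]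
    simp only [h1]
    rw [Finset.sum_comm]
    refine Finset.sum_eq_zero fun k _ => ?_
    have h2 : ∑ j, ∑ l, pd j (pd k (pd l (L i k j l))) x
        = - ∑ j, ∑ l, pd j (pd k (pd l (L i k j l))) x := by
      conv_lhs => rw [Finset.sum_comm]
      simp only [← Finset.sum_neg_distrib]
      refine Finset.sum_congr rfl fun j _ => Finset.sum_congr rfl fun l _ => ?_
      rw [hLanti i k l j, pd_neg, pd_neg, pd_neg, pd_comm (hLs _ _ _ _) k j,
        pd_comm ((hLs _ _ _ _).pd k), pd_comm (hLs _ _ _ _) l k]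
    linarith
  · rw [lap_sum fun k => ContDiff.sum fun l _ => hLpp _ _ _ _ _ _]
    funext x
    have h1 : ∀ k, lap (fun x => ∑ l, pd k (pd l (L i k j l)) x) x
        = pd k (fun x => x k * S i j x - x i * S k j x) x := by
      intro k
      have h2 : (fun x => x k * S i j x - x i * S k j x)
          = fun x => ∑ l, pd l (riemannProduct W i k j l) x := by
        funext y
        rw [sum_pd_riemannProduct hWs hWsym hWt, hWE, hWE]
      rw [h2, lap_sum fun l => hLpp _ _ _ _ _ _, pd_sum fun l => by
        rw [← hLl]; exact (hLs _ _ _ _).lap.pd l]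
      refine Finset.sum_congr rfl fun l _ => ?_
      rw [← hLl, pd_lap (hLs _ _ _ _), pd_lap ((hLs _ _ _ _).pd l)]
    simp only [h1]
    rw [sum_pd_coord_mul_sub (V := fun k => S k j) (fun k => hSs k j) (fun x => by
      simp only [hSsym _ j, hSt]), hSE]

end Potential

section Reconstruction

variable {D : ℕ}

/-- Adding a pure-trace term to a multiple of a symmetric transverse field `u` makes `Tform`
reduce to the Laplacian of `u`. -/
theorem Tform_of_transverse (hD : 3 ≤ D) {u : Fin D → Fin D → (Fin D → ℝ) → ℝ}
    (hu : ∀ i j, ContDiff ℝ ∞ (u i j))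
    (htrans : ∀ i x, ∑ j, pd j (u i j) x = 0) (i j : Fin D) (x : Fin D → ℝ) :
    Tform (1 / ((D : ℝ) - 2)) (1 / (((D : ℝ) - 1) * ((D : ℝ) - 2)))
      (fun i j x => ((D : ℝ) - 2) * u i j x + (if i = j then 1 else 0) * ∑ m, u m m x) i j x
      = lap (u i j) x := by
  set τ : (Fin D → ℝ) → ℝ := fun x => ∑ m, u m m x with hτ
  have hτs : ContDiff ℝ ∞ τ := ContDiff.sum fun m _ => hu m m
  set R : Fin D → Fin D → (Fin D → ℝ) → ℝ :=
    fun i j x => ((D : ℝ) - 2) * u i j x + (if i = j then 1 else 0) * τ x with hR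
  have hpp : ∀ i j k l, pd k (pd l (R i j)) = fun x =>
      ((D : ℝ) - 2) * pd k (pd l (u i j)) x + (if i = j then 1 else 0) * pd k (pd l τ) x := by
    intro i j k l
    simp only [hR]
    rw [pd_add (contDiff_const.mul (hu i j)) (contDiff_const.mul hτs),
      pd_const_mul (hu i j), pd_const_mul hτs,
      pd_add (contDiff_const.mul ((hu i j).pd l)) (contDiff_const.mul (hτs.pd l)),
      pd_const_mul ((hu i j).pd l), pd_const_mul (hτs.pd l)]
  have hlap : ∀ i j, lap (R i j) x
      = ((D : ℝ) - 2) * lap (u i j) x + (if i = j then 1 else 0) * lap τ x := fun i j => by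
    simp only [lap, hpp, Finset.sum_add_distrib, Finset.mul_sum]
  have htr : (fun y => ∑ m, R m m y) = fun y => (2 * (D : ℝ) - 2) * τ y := by
    funext y
    simp only [hR, if_true, Finset.sum_add_distrib, ← Finset.mul_sum]
    simp only [hτ, one_mul, Finset.sum_const, Finset.card_univ, Fintype.card_fin, nsmul_eq_mul]
    ring
  have hzero : ∀ i j, ∑ k, pd k (pd i (u j k)) x = 0 := fun i j => by
    have h : (fun x => ∑ k, pd k (u j k) x) = fun _ => 0 := funext (htrans j)
    have h2 := congrFun (congrArg (pd i) h) x
    rw [pd_sum fun k => (hu j k).pd k, pd_const] at h2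
    simpa only [pd_comm (hu j _) i] using h2
  have hdiv : ∀ i j, ∑ k, pd k (pd i (R j k)) x = pd i (pd j τ) x := fun i j => by
    simp only [hpp, Finset.sum_add_distrib, ← Finset.mul_sum, hzero]
    simp [pd_comm hτs j i]
  have hdd : ∑ k, ∑ p, pd k (pd p (R k p)) x = lap τ x := by
    have h : ∀ k, ∑ p, pd k (pd p (u k p)) x = 0 := fun k => by
      simpa only [pd_comm (hu k _) k] using hzero k k
    simp only [hpp, Finset.sum_add_distrib, ← Finset.mul_sum, h]
    simp [lap]
  have h1 : (D : ℝ) - 2 ≠ 0 := by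
    have : (3 : ℝ) ≤ D := by exact_mod_cast hD
    linarith
  have h2 : (D : ℝ) - 1 ≠ 0 := by
    have : (3 : ℝ) ≤ D := by exact_mod_cast hD
    linarith
  unfold Tform
  rw [htr, hlap, hdiv, hdiv, hdd, pd_const_mul hτs, pd_const_mul (hτs.pd j), lap_const_mul hτs,
    pd_comm hτs j i]
  field_simp
  ring

end Reconstruction

/-- Proposition 3, case D ≥ 4: every real-analytic symmetric transverse
tensor field on ℝ^D arises from some real-analytic symmetric R_{ij} via formula (16c)
with a = 1/(D−2), b = 1/((D−1)(D−2)). -/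
theorem stmt_8 (D : ℕ) (hD : 4 ≤ D)
    (T : Fin D → Fin D → (Fin D → ℝ) → ℝ)
    (hanalytic : ∀ i j, AnalyticOnNhd ℝ (T i j) Set.univ)
    (hsym : ∀ i j x, T i j x = T j i x)
    (htrans : ∀ i x, ∑ j, pd j (T i j) x = 0) :
    ∃ Rt : Fin D → Fin D → (Fin D → ℝ) → ℝ,
      (∀ i j, AnalyticOnNhd ℝ (Rt i j) Set.univ) ∧
      (∀ i j x, Rt i j x = Rt j i x) ∧
      (∀ i j x, T i j x
        = Tform (1 / ((D : ℝ) - 2)) (1 / (((D : ℝ) - 1) * ((D : ℝ) - 2))) Rt i j x) := by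
  have hT : ∀ i j, ContDiff ℝ ∞ (T i j) := fun i j =>
    contDiffOn_univ.1 ((hanalytic i j).contDiffOn uniqueDiffOn_univ)
  obtain ⟨u, hu, husym, hutrans, hulap⟩ := exists_transverse_lap_eq (by omega) hT
    (fun i j => funext (hsym i j)) htrans
  have hua : ∀ i j, AnalyticOnNhd ℝ (u i j) univ := fun i j =>
    analyticOnNhd_of_lap (hu i j) (by rw [hulap]; exact hanalytic i j)
  refine ⟨fun i j x => ((D : ℝ) - 2) * u i j x + (if i = j then 1 else 0) * ∑ m, u m m x,
    fun i j => ?_, fun i j x => ?_, fun i j x => ?_⟩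
  · exact (analyticOnNhd_const.mul (hua i j)).add
      (analyticOnNhd_const.mul (Finset.univ.analyticOnNhd_fun_sum fun m _ => hua m m))
  · simp only [husym i j, eq_comm (a := i)]
  · rw [Tform_of_transverse (by omega) hu hutrans, hulap]
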